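/- arXiv:0709.2493 — 5 statements merged into one kernel-verified Lean document; each statement's English description precedes it below -/
import Mathlib

section
/- Let 0 < ν < 1 and κ > 0. There exists a constant C = C(ν, κ) such that for every v ∈ ℝ³ with |v| ≤ ν, every σ with 0 < σ < κ, every s > 0, every x ∈ ℝ³ and every component index l ∈ {1,2,3}, one has |∫_{A(σ,κ)} (Σ_v(k))_l · cos(k·x − |k| s) dk| ≤ C (1 + |log σ|) / s. -/
open MeasureTheory
open scoped RealInnerProductSpace

noncomputable section

/-- ℝ³ as a Euclidean space. -/
abbrev E3 := EuclideanSpace ℝ (Fin 3)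

/-- The closed annulus `{k : a ≤ |k| ≤ b}` in ℝ³. -/
def annulus (a b : ℝ) : Set E3 := {k | a ≤ ‖k‖ ∧ ‖k‖ ≤ b}

/-- The soft-photon velocity field
`Σ_v(k) = (2 / (|k|² (1 − (k/|k|)·v))) • (v − ((k·v)/|k|²) k)`. -/
def Sig (v k : E3) : E3 :=
  (2 / (‖k‖ ^ 2 * (1 - ⟪k, v⟫ / ‖k‖))) • (v - (⟪k, v⟫ / ‖k‖ ^ 2) • k)


open Set Real in
lemma lin_mp (b : OrthonormalBasis (Fin 3) ℝ E3) :
    MeasurePreserving (fun p : ℝ × (ℝ × ℝ) => p.1 • b 0 + p.2.1 • b 1 + p.2.2 • b 2) volume volume := by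
  have h1 := (volume_preserving_piFinSuccAbove (fun _ : Fin 3 => ℝ) 0).symm
  have h2 := (volume_preserving_piFinTwo (fun _ : Fin 2 => ℝ)).symm
  have h3 : MeasurePreserving
      (Prod.map (id : ℝ → ℝ) (MeasurableEquiv.piFinTwo (fun _ : Fin 2 => ℝ)).symm)
      volume volume := (MeasurePreserving.id volume).prod h2
  have h4 := (PiLp.volume_preserving_toLp (Fin 3))
  have h5 := b.measurePreserving_repr_symm
  have h := h5.comp (h4.comp (h1.comp h3))
  convert h using 1
  ext1 p
  simp only [Function.comp]
  rw [← b.sum_repr_symm]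
  simp [Fin.sum_univ_three, MeasurableEquiv.piFinSuccAbove, MeasurableEquiv.piFinTwo, Fin.insertNthEquiv]

/-- Spherical coordinates `(φ, (r, θ))` adapted to an orthonormal basis. -/
def Psi (b : OrthonormalBasis (Fin 3) ℝ E3) (p : ℝ × (ℝ × ℝ)) : E3 :=
  (p.2.1 * Real.cos p.2.2) • b 0 + (p.2.1 * Real.sin p.2.2 * Real.cos p.1) • b 1
    + (p.2.1 * Real.sin p.2.2 * Real.sin p.1) • b 2

def sphM : Measure (ℝ × (ℝ × ℝ)) :=
  ((volume.restrict (Set.Ioo (-Real.pi) Real.pi)).prod (volume.restrict polarCoord.target)).withDensity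
    (fun p => ENNReal.ofReal p.2.1 * ENNReal.ofReal (p.2.1 * Real.sin p.2.2))

lemma Psi_cont (b : OrthonormalBasis (Fin 3) ℝ E3) : Continuous (Psi b) := by
  unfold Psi; fun_prop

open Set Real in
lemma lint_sph (F : ℝ × (ℝ × ℝ) → ENNReal) (hF : Measurable F) :
    ∫⁻ p, F p = ∫⁻ φ in Ioo (-π) π, ∫⁻ q in polarCoord.target,
      ENNReal.ofReal q.1 * ENNReal.ofReal (q.1 * sin q.2) *
        F (q.1 * cos q.2, (q.1 * sin q.2 * cos φ, q.1 * sin q.2 * sin φ)) := by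
  have e1 : ∫⁻ p, F p = ∫⁻ a, ∫⁻ q : ℝ × ℝ, F (a, q) := by
    rw [Measure.volume_eq_prod, lintegral_prod _ hF.aemeasurable]
  have e2 : ∀ a : ℝ, ∫⁻ q : ℝ × ℝ, F (a, q) = ∫⁻ φ in Ioo (-π) π, ∫⁻ ρ : ℝ,
      ENNReal.ofReal ρ * F (a, (ρ * cos φ, ρ * sin φ)) := by
    intro a
    rw [← lintegral_comp_polarCoord_symm (fun q => F (a, q))]
    simp only [polarCoord_target, polarCoord_symm_apply, smul_eq_mul]
    rw [Measure.volume_eq_prod, ← Measure.prod_restrict,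
      lintegral_prod_symm _ (by fun_prop)]
    refine lintegral_congr fun φ => ?_
    rw [← lintegral_indicator measurableSet_Ioi]
    refine lintegral_congr fun ρ => ?_
    by_cases h : ρ ∈ Ioi (0:ℝ)
    · simp [indicator_of_mem h]
    · simp [indicator_of_notMem h, ENNReal.ofReal_of_nonpos (not_lt.1 h)]
  rw [e1]
  simp_rw [e2]
  rw [lintegral_lintegral_swap]
  · refine lintegral_congr fun φ => ?_
    have e3 : ∫⁻ a : ℝ, ∫⁻ ρ : ℝ, ENNReal.ofReal ρ * F (a, (ρ * cos φ, ρ * sin φ))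
        = ∫⁻ z : ℝ × ℝ, ENNReal.ofReal z.2 * F (z.1, (z.2 * cos φ, z.2 * sin φ)) := by
      rw [Measure.volume_eq_prod, lintegral_prod _ (by fun_prop)]
    rw [e3, ← lintegral_comp_polarCoord_symm]
    simp only [polarCoord_symm_apply, smul_eq_mul, mul_assoc]
  · refine AEMeasurable.lintegral_prod_right' 
      (f := fun x : (ℝ × ℝ) × ℝ => ENNReal.ofReal x.2 * F (x.1.1, (x.2 * cos x.1.2, x.2 * sin x.1.2))) ?_
    fun_prop

open Set Real in
lemma Psi_mp (b : OrthonormalBasis (Fin 3) ℝ E3) : MeasurePreserving (Psi b) sphM volume := by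
  refine ⟨(Psi_cont b).measurable, ?_⟩
  refine Measure.ext_of_lintegral _ fun f hf => ?_
  rw [lintegral_map hf (Psi_cont b).measurable, ← (lin_mp b).lintegral_comp hf, lint_sph _ (by fun_prop), sphM,
    lintegral_withDensity_eq_lintegral_mul _ (by fun_prop) (g := fun a => f (Psi b a)) (hf.comp (Psi_cont b).measurable), lintegral_prod]
  · simp only [Psi, Pi.mul_apply]
  · have := (Psi_cont b).measurable
    fun_prop

open Set Real in
lemma int_sph (b : OrthonormalBasis (Fin 3) ℝ E3) (F : E3 → ℝ) (hF : Measurable F) :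
    ∫ k, F k = ∫ p in Ioo (-π) π ×ˢ polarCoord.target,
      (p.2.1 * max (p.2.1 * sin p.2.2) 0) * F (Psi b p) := by
  rw [← (Psi_mp b).map_eq, integral_map (Psi_cont b).measurable.aemeasurable hF.aestronglyMeasurable,
    sphM, integral_withDensity_eq_integral_toReal_smul (by fun_prop)
      (Filter.Eventually.of_forall fun x => by finiteness), Measure.prod_restrict, ← Measure.volume_eq_prod]
  refine setIntegral_congr_fun (measurableSet_Ioo.prod polarCoord.open_target.measurableSet) ?_
  intro p hp
  simp only [polarCoord_target, mem_prod, mem_Ioi] at hp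
  simp [ENNReal.toReal_ofReal', max_eq_left hp.2.1.le]

open Set Real in
lemma osc_theta (g g' : ℝ → ℝ) (D lam mu : ℝ) (hD : 0 ≤ D) (hlam : 0 < lam)
    (hg : ∀ t, HasDerivAt g (g' t) t) (hc : Continuous g')
    (hgD : ∀ t, |g t| ≤ D) (hgD' : ∀ t, |g' t| ≤ D) :
    |∫ t in Ioo 0 π, sin t * g t * cos (lam * cos t - mu)| ≤ (2 + π) * D / lam := by
  have hp := intervalIntegral.integral_mul_deriv_eq_deriv_mul (a := 0) (b := π) (u := g) (u' := g')
    (v := fun t => sin (lam * cos t - mu)) (v' := fun t => cos (lam * cos t - mu) * (lam * (- sin t)))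
    (fun t _ => hg t) (fun t _ => by
      have := (((hasDerivAt_cos t).const_mul lam).sub_const mu).sin
      exact this) (hc.intervalIntegrable _ _) (Continuous.intervalIntegrable (by fun_prop) _ _)
  have e1 : ∫ t in Ioo 0 π, sin t * g t * cos (lam * cos t - mu)
      = - lam⁻¹ * ∫ t in (0:ℝ)..π, g t * (cos (lam * cos t - mu) * (lam * (- sin t))) := by
    rw [← integral_Ioc_eq_integral_Ioo, ← intervalIntegral.integral_of_le pi_pos.le,
      ← intervalIntegral.integral_const_mul]
    congr 1; ext t; field_simp
  have b1 : ∀ t, |g t * sin (lam * cos t - mu)| ≤ D := fun t => by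
    rw [abs_mul]
    calc _ ≤ D * 1 := mul_le_mul (hgD t) (abs_sin_le_one _) (abs_nonneg _) hD
      _ = D := mul_one _
  have b2 : ‖∫ t in (0:ℝ)..π, g' t * sin (lam * cos t - mu)‖ ≤ D * |π - 0| := by
    apply intervalIntegral.norm_integral_le_of_norm_le_const
    intro t _
    rw [norm_eq_abs, abs_mul]
    calc _ ≤ D * 1 := mul_le_mul (hgD' t) (abs_sin_le_one _) (abs_nonneg _) hD
      _ = D := mul_one _
  rw [e1, hp, abs_mul, abs_neg, abs_of_pos (inv_pos.2 hlam), div_eq_inv_mul]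
  refine mul_le_mul_of_nonneg_left ?_ (inv_pos.2 hlam).le
  rw [sub_zero, abs_of_pos pi_pos, norm_eq_abs] at b2
  have := b1 0
  have := b1 π
  rw [abs_le] at *
  constructor <;> linarith

open Set Real in
lemma osc_r (a s0 s1 : ℝ) (h : s0 ≤ s1) (m : ℝ) (hm : 0 < m) (ha : m ≤ |a|) :
    |∫ r in Icc s0 s1, cos (r * a)| ≤ 2 / m := by
  have ha0 : a ≠ 0 := by rintro rfl; simp at ha; linarith
  rw [integral_Icc_eq_integral_Ioc, ← intervalIntegral.integral_of_le h,
    intervalIntegral.integral_comp_mul_right (fun x => cos x) ha0, integral_cos, smul_eq_mul, abs_mul, abs_inv]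
  have h1 : |sin (s1 * a) - sin (s0 * a)| ≤ 2 := by
    have := abs_le.1 (abs_sin_le_one (s1 * a)); have := abs_le.1 (abs_sin_le_one (s0 * a))
    rw [abs_le]; constructor <;> linarith
  rw [← div_eq_inv_mul]
  exact div_le_div₀ (by norm_num) h1 hm ha

def Om (b : OrthonormalBasis (Fin 3) ℝ E3) (φ t : ℝ) : E3 :=
  Real.cos t • b 0 + (Real.sin t * Real.cos φ) • b 1 + (Real.sin t * Real.sin φ) • b 2

lemma Om_def (b : OrthonormalBasis (Fin 3) ℝ E3) (φ t : ℝ) : Om b φ t =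
  Real.cos t • b 0 + (Real.sin t * Real.cos φ) • b 1 + (Real.sin t * Real.sin φ) • b 2 := rfl

def dOm (b : OrthonormalBasis (Fin 3) ℝ E3) (φ t : ℝ) : E3 :=
  (-Real.sin t) • b 0 + (Real.cos t * Real.cos φ) • b 1 + (Real.cos t * Real.sin φ) • b 2

lemma norm_sq_comb (b : OrthonormalBasis (Fin 3) ℝ E3) (x y z : ℝ) :
    ‖x • b 0 + y • b 1 + z • b 2‖ ^ 2 = x ^ 2 + y ^ 2 + z ^ 2 := by
  have h := b.sum_sq_norm_inner_right (x • b 0 + y • b 1 + z • b 2)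
  rw [← h]
  simp [Fin.sum_univ_three, inner_add_right, inner_smul_right, b.inner_eq_ite]

lemma norm_Om (b : OrthonormalBasis (Fin 3) ℝ E3) (φ t : ℝ) : ‖Om b φ t‖ = 1 := by
  have : ‖Om b φ t‖ ^ 2 = 1 := by
    rw [Om, norm_sq_comb]
    nlinarith [Real.sin_sq_add_cos_sq t, Real.sin_sq_add_cos_sq φ]
  exact (pow_eq_one_iff_of_nonneg (norm_nonneg _) two_ne_zero).1 this

lemma norm_dOm (b : OrthonormalBasis (Fin 3) ℝ E3) (φ t : ℝ) : ‖dOm b φ t‖ = 1 := by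
  have : ‖dOm b φ t‖ ^ 2 = 1 := by
    rw [dOm, norm_sq_comb]
    nlinarith [Real.sin_sq_add_cos_sq t, Real.sin_sq_add_cos_sq φ]
  exact (pow_eq_one_iff_of_nonneg (norm_nonneg _) two_ne_zero).1 this

lemma Psi_eq (b : OrthonormalBasis (Fin 3) ℝ E3) (φ r t : ℝ) : Psi b (φ, (r, t)) = r • Om b φ t := by
  simp only [Psi, Om, smul_add, smul_smul, mul_assoc]

lemma Om_deriv (b : OrthonormalBasis (Fin 3) ℝ E3) (φ t : ℝ) :
    HasDerivAt (Om b φ) (dOm b φ t) t := by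
  unfold Om dOm
  exact (((Real.hasDerivAt_cos t).smul_const _).add
    (((Real.hasDerivAt_sin t).mul_const _).smul_const _)).add
    (((Real.hasDerivAt_sin t).mul_const _).smul_const _)

def gg (b : OrthonormalBasis (Fin 3) ℝ E3) (v e : E3) (φ t : ℝ) : ℝ :=
  2 * (⟪v, e⟫ - ⟪Om b φ t, v⟫ * ⟪Om b φ t, e⟫) / (1 - ⟪Om b φ t, v⟫)

def dgg (b : OrthonormalBasis (Fin 3) ℝ E3) (v e : E3) (φ t : ℝ) : ℝ :=
  ((2 * -(⟪dOm b φ t, v⟫ * ⟪Om b φ t, e⟫ + ⟪Om b φ t, v⟫ * ⟪dOm b φ t, e⟫)) * (1 - ⟪Om b φ t, v⟫)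
    - (2 * (⟪v, e⟫ - ⟪Om b φ t, v⟫ * ⟪Om b φ t, e⟫)) * (-⟪dOm b φ t, v⟫)) / (1 - ⟪Om b φ t, v⟫) ^ 2

lemma inner_le_of (w : E3) (hw : ‖w‖ = 1) (v : E3) (ν : ℝ) (hv : ‖v‖ ≤ ν) : |⟪w, v⟫| ≤ ν := by
  refine (abs_real_inner_le_norm w v).trans ?_
  rw [hw, one_mul]; exact hv

lemma den_pos (b : OrthonormalBasis (Fin 3) ℝ E3) (v : E3) (ν : ℝ) (hν1 : ν < 1) (hv : ‖v‖ ≤ ν) (φ t : ℝ) : 0 < 1 - ⟪Om b φ t, v⟫ := by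
  have := (abs_le.1 (inner_le_of _ (norm_Om b φ t) v ν hv)).2
  linarith

lemma gg_deriv (b : OrthonormalBasis (Fin 3) ℝ E3) (v e : E3)
    (ν : ℝ) (hν1 : ν < 1) (hv : ‖v‖ ≤ ν) (φ t : ℝ) : HasDerivAt (gg b v e φ) (dgg b v e φ t) t := by
  have h1 : ∀ w : E3, HasDerivAt (fun t => ⟪Om b φ t, w⟫) ⟪dOm b φ t, w⟫ t := fun w => by
    have := (Om_deriv b φ t).inner ℝ (hasDerivAt_const t w)
    simpa using this
  have h2 := ((((h1 v).mul (h1 e)).const_sub ⟪v, e⟫).const_mul 2).div ((h1 v).const_sub 1)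
    (den_pos b v ν hν1 hv φ t).ne'
  exact h2

lemma Om_cont (b : OrthonormalBasis (Fin 3) ℝ E3) : Continuous (fun p : ℝ × ℝ => Om b p.1 p.2) := by
  unfold Om; fun_prop

lemma dOm_cont (b : OrthonormalBasis (Fin 3) ℝ E3) : Continuous (fun p : ℝ × ℝ => dOm b p.1 p.2) := by
  unfold dOm; fun_prop

lemma gg_cont (b : OrthonormalBasis (Fin 3) ℝ E3) (v e : E3)
    (ν : ℝ) (hν1 : ν < 1) (hv : ‖v‖ ≤ ν) : Continuous (fun p : ℝ × ℝ => gg b v e p.1 p.2) := by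
  unfold gg
  have := Om_cont b
  exact Continuous.div (by fun_prop) (by fun_prop) (fun p => (den_pos b v ν hν1 hv p.1 p.2).ne')

lemma dgg_cont (b : OrthonormalBasis (Fin 3) ℝ E3) (v e : E3)
    (ν : ℝ) (hν1 : ν < 1) (hv : ‖v‖ ≤ ν) : Continuous (fun p : ℝ × ℝ => dgg b v e p.1 p.2) := by
  unfold dgg
  have := Om_cont b
  have := dOm_cont b
  exact Continuous.div (by fun_prop) (by fun_prop)
    (fun p => (pow_pos (den_pos b v ν hν1 hv p.1 p.2) 2).ne')

lemma abs_mul_le_one {x y : ℝ} (hx : |x| ≤ 1) (hy : |y| ≤ 1) : |x * y| ≤ 1 := by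
  rw [abs_mul]; exact mul_le_one₀ hx (abs_nonneg _) hy

lemma gg_bd (b : OrthonormalBasis (Fin 3) ℝ E3) (v e : E3)
    (ν : ℝ) (hν1 : ν < 1) (hv : ‖v‖ ≤ ν) (he : ‖e‖ = 1) (φ t : ℝ) : |gg b v e φ t| ≤ 12 / (1 - ν) ^ 2 := by
  have hd := den_pos b v ν hν1 hv φ t
  have a1 := inner_le_of _ (norm_Om b φ t) v ν hv
  have a2 := inner_le_of _ (norm_Om b φ t) e 1 he.le
  have a3 : |⟪v, e⟫| ≤ 1 := by
    rw [real_inner_comm]; exact (inner_le_of _ he v ν hv).trans hν1.le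
  have hν0 : 0 ≤ ν := (norm_nonneg _).trans hv
  have a4 := abs_mul_le_one (a1.trans hν1.le) a2
  rw [gg, abs_div, abs_of_pos hd]
  have a5 : |2 * (⟪v, e⟫ - ⟪Om b φ t, v⟫ * ⟪Om b φ t, e⟫)| ≤ 12 := by
    rw [abs_le] at *; constructor <;> linarith
  refine div_le_div₀ (by norm_num) a5 (by nlinarith) ?_
  have := (abs_le.1 a1).2
  nlinarith

lemma dgg_bd (b : OrthonormalBasis (Fin 3) ℝ E3) (v e : E3)
    (ν : ℝ) (hν1 : ν < 1) (hv : ‖v‖ ≤ ν) (he : ‖e‖ = 1) (φ t : ℝ) : |dgg b v e φ t| ≤ 12 / (1 - ν) ^ 2 := by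
  have hd := den_pos b v ν hν1 hv φ t
  have a1 := inner_le_of _ (norm_Om b φ t) v ν hv
  have a2 := inner_le_of _ (norm_Om b φ t) e 1 he.le
  have d1 := (inner_le_of _ (norm_dOm b φ t) v ν hv).trans hν1.le
  have d2 := inner_le_of _ (norm_dOm b φ t) e 1 he.le
  have a3 : |⟪v, e⟫| ≤ 1 := by
    rw [real_inner_comm]; exact (inner_le_of _ he v ν hv).trans hν1.le
  have hν0 : 0 ≤ ν := (norm_nonneg _).trans hv
  have a1' := a1.trans hν1.le
  rw [dgg, abs_div, abs_of_pos (pow_pos hd 2)]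
  have hle := (abs_le.1 a1).2
  refine div_le_div₀ (by norm_num) ?_ (by nlinarith) (by gcongr)
  have c1 := abs_mul_le_one d1 a2
  have c2 := abs_mul_le_one a1' d2
  have c3 := abs_mul_le_one a1' a2
  have c4 : |1 - ⟪Om b φ t, v⟫| ≤ 2 := by
    rw [abs_le] at *; constructor <;> linarith
  have c5 : |2 * -(⟪dOm b φ t, v⟫ * ⟪Om b φ t, e⟫ + ⟪Om b φ t, v⟫ * ⟪dOm b φ t, e⟫)| ≤ 4 := by
    rw [abs_le] at *; constructor <;> linarith
  have c6 : |2 * (⟪v, e⟫ - ⟪Om b φ t, v⟫ * ⟪Om b φ t, e⟫)| ≤ 4 := by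
    rw [abs_le] at *; constructor <;> linarith
  refine (abs_sub _ _).trans ?_
  rw [abs_mul, abs_mul _ (-⟪dOm b φ t, v⟫), abs_neg ⟪dOm b φ t, v⟫]
  have := mul_le_mul c5 c4 (abs_nonneg _) (by norm_num)
  have := mul_le_mul c6 d1 (abs_nonneg _) (by norm_num)
  linarith

lemma Sig_inner (b : OrthonormalBasis (Fin 3) ℝ E3) (v : E3) (φ r t : ℝ) (hr : 0 < r) (l : Fin 3) :
    r ^ 2 * (Sig v (r • Om b φ t)) l = gg b v (EuclideanSpace.single l 1) φ t := by
  have h0 : ∀ w : E3, w l = ⟪w, EuclideanSpace.single l (1:ℝ)⟫ := fun w => by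
    simp [EuclideanSpace.inner_single_right]
  rw [h0, Sig, gg]
  set e : E3 := EuclideanSpace.single l (1:ℝ)
  have hn : ‖r • Om b φ t‖ = r := by rw [norm_smul, norm_Om, mul_one, Real.norm_of_nonneg hr.le]
  rw [hn]
  simp only [inner_smul_left, inner_sub_left, RCLike.conj_to_real]
  rw [mul_div_cancel_left₀ _ hr.ne']
  field_simp

attribute [irreducible] gg dgg Om dOm

lemma exists_basis (x : E3) : ∃ b : OrthonormalBasis (Fin 3) ℝ E3, x = ‖x‖ • b 0 := by
  by_cases hx : x = 0
  · exact ⟨EuclideanSpace.basisFun (Fin 3) ℝ, by simp [hx]⟩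
  · have ho : Orthonormal ℝ (({0} : Set (Fin 3)).domRestrict (fun _ => (‖x‖⁻¹ • x : E3))) := by
      constructor
      · intro i
        change ‖(‖x‖⁻¹ • x : E3)‖ = 1
        simp [norm_smul, hx]
      · intro i j hij
        exact absurd (Subsingleton.elim i j) hij
    obtain ⟨b, hb⟩ := ho.exists_orthonormalBasis_extension_of_card_eq (by simp)
    refine ⟨b, ?_⟩
    rw [hb 0 rfl, smul_smul, mul_inv_cancel₀ (norm_ne_zero_iff.2 hx), one_smul]

lemma Sig_meas (v : E3) (l : Fin 3) : Measurable (fun k => (Sig v k) l) := by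
  have h : Measurable (Sig v) := by unfold Sig; fun_prop
  fun_prop

def integrand (b : OrthonormalBasis (Fin 3) ℝ E3) (v e : E3) (X s : ℝ) (p : ℝ × (ℝ × ℝ)) : ℝ :=
  Real.sin p.2.2 * gg b v e p.1 p.2.2 * Real.cos (p.2.1 * (X * Real.cos p.2.2 - s))

lemma integrand_cont (b : OrthonormalBasis (Fin 3) ℝ E3) (v e : E3) (ν : ℝ) (hν1 : ν < 1) (hv : ‖v‖ ≤ ν)
    (X s : ℝ) : Continuous (integrand b v e X s) := by
  have h1 : Continuous (fun p : ℝ × (ℝ × ℝ) => ((p.1, p.2.2) : ℝ × ℝ)) := by fun_prop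
  have h2 : Continuous (fun p : ℝ × (ℝ × ℝ) => gg b v e p.1 p.2.2) :=
    Continuous.comp (g := fun p : ℝ × ℝ => gg b v e p.1 p.2) (gg_cont b v e ν hν1 hv) h1
  have h3 : Continuous (fun p : ℝ × (ℝ × ℝ) => Real.sin p.2.2) := by fun_prop
  have h4 : Continuous (fun p : ℝ × (ℝ × ℝ) => Real.cos (p.2.1 * (X * Real.cos p.2.2 - s))) := by
    fun_prop
  exact (h3.mul h2).mul h4

open Set Real in
lemma main_rep (b : OrthonormalBasis (Fin 3) ℝ E3) (v x : E3) (hx : x = ‖x‖ • b 0) (s σ κ : ℝ)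
    (hσ : 0 < σ) (l : Fin 3) :
    ∫ k in annulus σ κ, (Sig v k) l * Real.cos (⟪k, x⟫ - ‖k‖ * s) =
      ∫ p in Ioo (-π) π ×ˢ (Icc σ κ ×ˢ Ioo 0 π), integrand b v (EuclideanSpace.single l 1) ‖x‖ s p := by
  have hA : MeasurableSet (annulus σ κ) :=
    (measurableSet_le measurable_const measurable_norm).inter
      (measurableSet_le measurable_norm measurable_const)
  rw [← integral_indicator hA, int_sph b]
  swap
  · refine Measurable.indicator ?_ hA
    have := Sig_meas v l
    fun_prop
  rw [← integral_indicator (measurableSet_Ioo.prod polarCoord.open_target.measurableSet),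
    ← integral_indicator (measurableSet_Ioo.prod (measurableSet_Icc.prod measurableSet_Ioo))]
  congr 1
  ext ⟨φ, r, t⟩
  by_cases hr : 0 < r
  · have hn : ‖Psi b (φ, (r, t))‖ = r := by
      rw [Psi_eq, norm_smul, norm_Om, mul_one, Real.norm_of_nonneg hr.le]
    have hin : ⟪Psi b (φ, (r, t)), x⟫ = r * (‖x‖ * cos t) := by
      rw [hx, norm_smul, b.norm_eq_one, mul_one, norm_norm]
      simp only [Psi_eq, Om_def, inner_smul_left, inner_smul_right, inner_add_left, b.inner_eq_ite]
      simp
      ring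
    by_cases hrm : r ∈ Icc σ κ
    · have hPA : Psi b (φ, (r, t)) ∈ annulus σ κ := by
        simp only [annulus, mem_ofPred_eq, hn]; exact hrm
      by_cases hφ : φ ∈ Ioo (-π) π
      · by_cases ht : t ∈ Ioo 0 π
        · have ht' : t ∈ Ioo (-π) π := ⟨by linarith [ht.1, pi_pos], ht.2⟩
          have hs := sin_pos_of_pos_of_lt_pi ht.1 ht.2
          have hT : (φ, (r, t)) ∈ Ioo (-π) π ×ˢ polarCoord.target := by
            rw [polarCoord_target]; exact ⟨hφ, hr, ht'⟩
          have hT2 : (φ, (r, t)) ∈ Ioo (-π) π ×ˢ (Icc σ κ ×ˢ Ioo 0 π) := ⟨hφ, hrm, ht⟩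
          rw [indicator_of_mem hT,
            indicator_of_mem hT2, indicator_of_mem hPA, hn, hin, integrand,
            ← Sig_inner b v φ r t hr l, Psi_eq, max_eq_left (by positivity)]
          simp only []
          rw [show r * (‖x‖ * cos t) - r * s = r * (‖x‖ * cos t - s) by ring]
          ring
        · rw [indicator_of_notMem (s := Ioo (-π) π ×ˢ (Icc σ κ ×ˢ Ioo 0 π)) (fun h => ht h.2.2)]
          refine indicator_apply_eq_zero.2 fun h => ?_
          rw [polarCoord_target] at h
          have ht1 : t ≤ 0 := by
            by_contra h'
            exact ht ⟨not_le.1 h', h.2.2.2⟩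
          have := sin_nonpos_of_nonpos_of_neg_pi_le ht1 h.2.2.1.le
          rw [max_eq_right (by simp only []; nlinarith)]
          simp
      · rw [indicator_of_notMem (fun h => hφ h.1), indicator_of_notMem (fun h => hφ h.1)]
    · have hPA : Psi b (φ, (r, t)) ∉ annulus σ κ := by
        simp only [annulus, mem_ofPred_eq, hn]; exact hrm
      rw [indicator_of_notMem (s := Ioo (-π) π ×ˢ (Icc σ κ ×ˢ Ioo 0 π)) (fun h => hrm h.2.1)]
      refine indicator_apply_eq_zero.2 fun h => ?_
      rw [indicator_of_notMem hPA, mul_zero]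
  · rw [indicator_of_notMem, indicator_of_notMem]
    · exact fun h => hr (hσ.trans_le h.2.1.1)
    · rw [polarCoord_target]; exact fun h => hr h.2.1

open Set Real in
lemma bound_large (b : OrthonormalBasis (Fin 3) ℝ E3) (v e : E3) (ν : ℝ) (hν1 : ν < 1) (hv : ‖v‖ ≤ ν)
    (he : ‖e‖ = 1) (X s σ κ : ℝ) (hX : 0 < X) (hσ : 0 < σ) (hσκ : σ ≤ κ)
    (hint : IntegrableOn (integrand b v e X s) (Ioo (-π) π ×ˢ (Icc σ κ ×ˢ Ioo 0 π))) :
    |∫ p in Ioo (-π) π ×ˢ (Icc σ κ ×ˢ Ioo 0 π), integrand b v e X s p| ≤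
      ((2 + π) * (12 / (1 - ν) ^ 2) / X * log (κ / σ)) * (2 * π) := by
  have hcont := integrand_cont b v e ν hν1 hv X s
  rw [Measure.volume_eq_prod, setIntegral_prod _ (by rwa [← Measure.volume_eq_prod])]
  have hD : (0:ℝ) ≤ 12 / (1 - ν) ^ 2 := by positivity
  have inner : ∀ φ, ‖∫ q in Icc σ κ ×ˢ Ioo 0 π, integrand b v e X s (φ, q)‖ ≤
      (2 + π) * (12 / (1 - ν) ^ 2) / X * log (κ / σ) := by
    intro φ
    have hi : IntegrableOn (fun q => integrand b v e X s (φ, q)) (Icc σ κ ×ˢ Ioo 0 π) :=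
      ((by fun_prop : Continuous (fun q => integrand b v e X s (φ, q))).continuousOn.integrableOn_compact
        (isCompact_Icc.prod isCompact_Icc)).mono_set (prod_mono_right Ioo_subset_Icc_self)
    rw [Measure.volume_eq_prod, setIntegral_prod _ (by rwa [← Measure.volume_eq_prod])]
    have hlog : ∫ r in Icc σ κ, (2 + π) * (12 / (1 - ν) ^ 2) / X * r⁻¹ =
        (2 + π) * (12 / (1 - ν) ^ 2) / X * log (κ / σ) := by
      rw [integral_const_mul, integral_Icc_eq_integral_Ioc, ← intervalIntegral.integral_of_le hσκ,
        integral_inv_of_pos hσ (hσ.trans_le hσκ)]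
    rw [← hlog]
    refine norm_integral_le_of_norm_le ?_ ?_
    · refine ContinuousOn.integrableOn_compact isCompact_Icc ?_
      refine continuousOn_const.mul (continuousOn_inv₀.mono fun r hr => ?_)
      exact (hσ.trans_le hr.1).ne'
    · refine (ae_restrict_iff' measurableSet_Icc).2 (Filter.Eventually.of_forall fun r hr => ?_)
      have hr0 : 0 < r := hσ.trans_le hr.1
      have := osc_theta (gg b v e φ) (dgg b v e φ) (12 / (1 - ν) ^ 2) (r * X) (r * s) hD (by positivity)
        (gg_deriv b v e ν hν1 hv φ)
        ((dgg_cont b v e ν hν1 hv).comp (by fun_prop : Continuous (fun t : ℝ => (φ, t))))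
        (gg_bd b v e ν hν1 hv he φ) (dgg_bd b v e ν hν1 hv he φ)
      rw [norm_eq_abs]
      have ef : (fun t => integrand b v e X s (φ, (r, t))) =
          fun t => sin t * gg b v e φ t * cos (r * X * cos t - r * s) := by
        funext t
        simp only [integrand]
        rw [show r * (X * cos t - s) = r * X * cos t - r * s by ring]
      rw [ef]
      refine this.trans (le_of_eq ?_)
      generalize 12 / (1 - ν) ^ 2 = D
      field_simp
  have := norm_setIntegral_le_of_norm_le_const (μ := volume) (s := Ioo (-π) π)
    (by simp) (fun φ _ => inner φ)
  rw [norm_eq_abs] at this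
  refine this.trans (le_of_eq ?_)
  rw [measureReal_def, Real.volume_Ioo, ENNReal.toReal_ofReal (by linarith [pi_pos])]
  ring

open Set Real in
lemma bound_small (b : OrthonormalBasis (Fin 3) ℝ E3) (v e : E3) (ν : ℝ) (hν1 : ν < 1) (hv : ‖v‖ ≤ ν)
    (he : ‖e‖ = 1) (X s σ κ : ℝ) (hX : 0 ≤ X) (hs : 0 < s) (hXs : X ≤ s / 2) (hσκ : σ ≤ κ)
    (hint : IntegrableOn (integrand b v e X s) (Ioo (-π) π ×ˢ (Icc σ κ ×ˢ Ioo 0 π))) :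
    |∫ p in Ioo (-π) π ×ˢ (Icc σ κ ×ˢ Ioo 0 π), integrand b v e X s p| ≤
      ((12 / (1 - ν) ^ 2 * (4 / s)) * π) * (2 * π) := by
  have hcont := integrand_cont b v e ν hν1 hv X s
  rw [Measure.volume_eq_prod, setIntegral_prod _ (by rwa [← Measure.volume_eq_prod])]
  have hD : (0:ℝ) ≤ 12 / (1 - ν) ^ 2 := by positivity
  have inner : ∀ φ, ‖∫ q in Icc σ κ ×ˢ Ioo 0 π, integrand b v e X s (φ, q)‖ ≤
      (12 / (1 - ν) ^ 2 * (4 / s)) * π := by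
    intro φ
    have hi : IntegrableOn (fun q => integrand b v e X s (φ, q)) (Icc σ κ ×ˢ Ioo 0 π) :=
      ((by fun_prop : Continuous (fun q => integrand b v e X s (φ, q))).continuousOn.integrableOn_compact
        (isCompact_Icc.prod isCompact_Icc)).mono_set (prod_mono_right Ioo_subset_Icc_self)
    rw [IntegrableOn, Measure.volume_eq_prod, ← Measure.prod_restrict] at hi
    rw [Measure.volume_eq_prod, ← Measure.prod_restrict, integral_prod_symm _ hi]
    have inner2 : ∀ t, ‖∫ r in Icc σ κ, integrand b v e X s (φ, (r, t))‖ ≤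
        12 / (1 - ν) ^ 2 * (4 / s) := by
      intro t
      simp only [integrand]
      rw [integral_const_mul, norm_mul, norm_mul, norm_eq_abs, norm_eq_abs, norm_eq_abs]
      have h1 := osc_r (X * cos t - s) σ κ hσκ (s / 2) (by linarith) (by
        rw [abs_sub_comm]
        refine le_trans ?_ (le_abs_self _)
        nlinarith [cos_le_one t])
      have h2 : |sin t| * |gg b v e φ t| ≤ 12 / (1 - ν) ^ 2 := by
        have := mul_le_mul (abs_sin_le_one t) (gg_bd b v e ν hν1 hv he φ t) (abs_nonneg _) zero_le_one
        linarith
      have h3 : 2 / (s / 2) = 4 / s := by field_simp; norm_num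
      rw [h3] at h1
      exact mul_le_mul h2 h1 (abs_nonneg _) hD
    have := norm_setIntegral_le_of_norm_le_const (μ := volume) (s := Ioo 0 π)
      (by simp) (fun t _ => inner2 t)
    refine this.trans (le_of_eq ?_)
    rw [measureReal_def, Real.volume_Ioo, ENNReal.toReal_ofReal (by linarith [pi_pos])]
    ring
  have := norm_setIntegral_le_of_norm_le_const (μ := volume) (s := Ioo (-π) π)
    (by simp) (fun φ _ => inner φ)
  rw [norm_eq_abs] at this
  refine this.trans (le_of_eq ?_)
  rw [measureReal_def, Real.volume_Ioo, ENNReal.toReal_ofReal (by linarith [pi_pos])]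
  ring

open Set Real in
lemma integrand_int (b : OrthonormalBasis (Fin 3) ℝ E3) (v e : E3) (ν : ℝ) (hν1 : ν < 1) (hv : ‖v‖ ≤ ν)
    (X s σ κ : ℝ) :
    IntegrableOn (integrand b v e X s) (Ioo (-π) π ×ˢ (Icc σ κ ×ˢ Ioo 0 π)) := by
  have hcont := integrand_cont b v e ν hν1 hv X s
  exact (hcont.continuousOn.integrableOn_compact
    (isCompact_Icc.prod (isCompact_Icc.prod isCompact_Icc))).mono_set
    (prod_mono Ioo_subset_Icc_self (prod_mono_right Ioo_subset_Icc_self))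

/-- Lemma A.2, first estimate: uniform (up to a logarithm in the infrared cutoff σ)
`1/s`-decay of the oscillatory integral. -/
theorem statement0 (ν κ : ℝ) (hν0 : 0 < ν) (hν1 : ν < 1) (hκ : 0 < κ) :
    ∃ C : ℝ, ∀ v : E3, ‖v‖ ≤ ν → ∀ σ : ℝ, 0 < σ → σ < κ →
      ∀ s : ℝ, 0 < s → ∀ x : E3, ∀ l : Fin 3,
      |∫ k in annulus σ κ, (Sig v k) l * Real.cos (⟪k, x⟫ - ‖k‖ * s)| ≤
        C * (1 + |Real.log σ|) / s := by
  refine ⟨8 * Real.pi * (2 + Real.pi) * (12 / (1 - ν) ^ 2) * (1 + |Real.log κ|), ?_⟩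
  intro v hv σ hσ hσκ s hs x l
  obtain ⟨b, hb⟩ := exists_basis x
  rw [main_rep b v x hb s σ κ hσ l]
  have he : ‖(EuclideanSpace.single l 1 : E3)‖ = 1 := by simp
  have hint := integrand_int b v (EuclideanSpace.single l 1) ν hν1 hv ‖x‖ s σ κ
  have hpi := Real.pi_pos
  have hD : (0:ℝ) ≤ 12 / (1 - ν) ^ 2 := by positivity
  have hL1 : 0 ≤ |Real.log κ| := abs_nonneg _
  have hL2 : 0 ≤ |Real.log σ| := abs_nonneg _
  rcases le_or_gt ‖x‖ (s / 2) with hc | hc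
  · refine (bound_small b v _ ν hν1 hv he ‖x‖ s σ κ (norm_nonneg _) hs hc hσκ.le hint).trans ?_
    rw [le_div_iff₀ hs]
    have e1 : 12 / (1 - ν) ^ 2 * (4 / s) * Real.pi * (2 * Real.pi) * s
        = 8 * Real.pi * (12 / (1 - ν) ^ 2) * (Real.pi * 1 * 1) := by
      field_simp; ring
    have e2 : 8 * Real.pi * (2 + Real.pi) * (12 / (1 - ν) ^ 2) * (1 + |Real.log κ|) * (1 + |Real.log σ|)
        = 8 * Real.pi * (12 / (1 - ν) ^ 2) * ((2 + Real.pi) * (1 + |Real.log κ|) * (1 + |Real.log σ|)) := by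
      ring
    rw [e1, e2]
    gcongr <;> linarith
  · have hx0 : 0 < ‖x‖ := by linarith
    refine (bound_large b v _ ν hν1 hv he ‖x‖ s σ κ hx0 hσ hσκ.le hint).trans ?_
    have hl : Real.log (κ / σ) ≤ (1 + |Real.log κ|) * (1 + |Real.log σ|) := by
      rw [Real.log_div hκ.ne' hσ.ne']
      have := le_abs_self (Real.log κ)
      have := neg_abs_le (Real.log σ)
      nlinarith
    have hi : ‖x‖⁻¹ ≤ 2 / s := by
      rw [← inv_div]; exact inv_anti₀ (by linarith) hc.le
    have e1 : (2 + Real.pi) * (12 / (1 - ν) ^ 2) / ‖x‖ * Real.log (κ / σ) * (2 * Real.pi)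
        = (2 * Real.pi * (2 + Real.pi) * (12 / (1 - ν) ^ 2)) * (‖x‖⁻¹ * Real.log (κ / σ)) := by
      ring
    have e3 : ‖x‖⁻¹ * Real.log (κ / σ) ≤ (4 / s) * ((1 + |Real.log κ|) * (1 + |Real.log σ|)) := by
      refine (mul_le_mul_of_nonneg_left hl (by positivity)).trans ?_
      refine mul_le_mul_of_nonneg_right (hi.trans ?_) (by positivity)
      gcongr; norm_num
    rw [e1]
    refine (mul_le_mul_of_nonneg_left e3 (by positivity)).trans (le_of_eq ?_)
    ring
end
end

section
/- Let 0 < ν_min ≤ ν_max < 1 and κ > 0. There exists a constant C = C(ν_min, ν_max, κ) such that for every v ∈ ℝ³ with |v| ≤ ν_max, every μ ∈ (0, κ], every s > 0, every x ∈ ℝ³ with ν_min s ≤ |x| ≤ ν_max s, and every component index l ∈ {1,2,3}, one has |∫_{A(μ,κ)} (Σ_v(k))_l · cos(k·x − |k| s) dk| ≤ C / (μ s²). In particular, taking μ = t^{−θ} with θ ∈ (0,1) and s ≥ t ≥ 1 gives the bound C t^θ / s². -/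
open MeasureTheory
open scoped RealInnerProductSpace

noncomputable section

lemma aux_ibp (G G' : ℝ → ℝ) (hG : ∀ θ, HasDerivAt G (G' θ) θ) (hG'c : Continuous G')
    (A A' X s a δ : ℝ) (hA : ∀ θ, |G θ| ≤ A) (hA' : ∀ θ, |G' θ| ≤ A') (hX : 0 < X) (hs : 0 < s)
    (ha : 0 < a) (hδ : 0 < δ) (hXs : X ≤ (1 - δ) * s) :
    |∫ θ in (0:ℝ)..Real.pi, G θ * Real.sin θ *
      (Real.sin (a * (X * Real.cos θ - s)) / (X * Real.cos θ - s))| ≤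
      1 / (a * X) * (2 * (A / (δ * s)) + Real.pi * (A' / (δ * s) + A * X / (δ * s) ^ 2)) := by
  have hGc : Continuous G := continuous_iff_continuousAt.2 fun θ => (hG θ).continuousAt
  have hD : ∀ θ, δ * s ≤ |X * Real.cos θ - s| := by
    intro θ
    rw [abs_sub_comm]
    refine le_trans ?_ (le_abs_self _)
    nlinarith [Real.cos_le_one θ]
  have hds : 0 < δ * s := by positivity
  have hD0 : ∀ θ, X * Real.cos θ - s ≠ 0 := fun θ => abs_pos.1 (hds.trans_le (hD θ))
  have hA0 : 0 ≤ A := (abs_nonneg _).trans (hA 0)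
  have hA'0 : 0 ≤ A' := (abs_nonneg _).trans (hA' 0)
  set u : ℝ → ℝ := fun θ => G θ / (X * Real.cos θ - s) with hu
  set u' : ℝ → ℝ := fun θ => (G' θ * (X * Real.cos θ - s) - G θ * (X * (-Real.sin θ))) /
    (X * Real.cos θ - s) ^ 2 with hu'
  set w : ℝ → ℝ := fun θ => Real.cos (a * (X * Real.cos θ - s)) / (a * X) with hw
  set w' : ℝ → ℝ := fun θ => Real.sin θ * Real.sin (a * (X * Real.cos θ - s)) with hw'
  have hdD : ∀ θ, HasDerivAt (fun θ => X * Real.cos θ - s) (X * (-Real.sin θ)) θ := fun θ =>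
    ((Real.hasDerivAt_cos θ).const_mul X).sub_const s
  have hdu : ∀ θ, HasDerivAt u (u' θ) θ := fun θ => (hG θ).div (hdD θ) (hD0 θ)
  have hdw : ∀ θ, HasDerivAt w (w' θ) θ := by
    intro θ
    have := (((hdD θ).const_mul a).cos).div_const (a * X)
    refine HasDerivAt.congr_deriv this ?_
    simp only [hw']
    field_simp
  have hu'c : Continuous u' := by
    simp only [hu']
    refine Continuous.div (by fun_prop) (by fun_prop) fun θ => pow_ne_zero _ (hD0 θ)
  have hw'c : Continuous w' := by simp only [hw']; fun_prop
  have key := intervalIntegral.integral_mul_deriv_eq_deriv_mul (a := 0) (b := Real.pi)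
    (fun x _ => hdu x) (fun x _ => hdw x) (hu'c.intervalIntegrable _ _)
    (hw'c.intervalIntegrable _ _)
  have hrw : ∀ θ, G θ * Real.sin θ *
      (Real.sin (a * (X * Real.cos θ - s)) / (X * Real.cos θ - s)) = u θ * w' θ := by
    intro θ; simp only [hu, hw']; ring
  simp_rw [hrw]
  rw [key]
  have hub : ∀ θ, |u θ| ≤ A / (δ * s) := by
    intro θ
    simp only [hu, abs_div]
    exact div_le_div₀ hA0 (hA θ) hds (hD θ)
  have hwb : ∀ θ, |w θ| ≤ 1 / (a * X) := by
    intro θ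
    simp only [hw, abs_div]
    rw [abs_of_pos (show 0 < a * X by positivity)]
    gcongr
    exact Real.abs_cos_le_one _
  have hu'b : ∀ θ, |u' θ| ≤ A' / (δ * s) + A * X / (δ * s) ^ 2 := by
    intro θ
    have : u' θ = G' θ / (X * Real.cos θ - s) + G θ * (X * Real.sin θ) / (X * Real.cos θ - s) ^ 2 := by
      simp only [hu']
      have := hD0 θ
      field_simp
      ring
    rw [this]
    refine (abs_add_le _ _).trans (add_le_add ?_ ?_)
    · rw [abs_div]
      exact div_le_div₀ hA'0 (hA' θ) hds (hD θ)
    · rw [abs_div, abs_mul, abs_mul, abs_pow, abs_of_pos hX]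
      refine div_le_div₀ (by positivity) ?_ (by positivity) (by gcongr; exact hD θ)
      refine mul_le_mul (hA θ) ?_ (by positivity) hA0
      nlinarith [Real.abs_sin_le_one θ]
  have hI : |∫ x in (0:ℝ)..Real.pi, u' x * w x| ≤
      (A' / (δ * s) + A * X / (δ * s) ^ 2) * (1 / (a * X)) * Real.pi := by
    have := intervalIntegral.norm_integral_le_of_norm_le_const (a := 0) (b := Real.pi)
      (f := fun x => u' x * w x) (C := (A' / (δ * s) + A * X / (δ * s) ^ 2) * (1 / (a * X)))
      (fun x _ => by
        rw [Real.norm_eq_abs, abs_mul]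
        exact mul_le_mul (hu'b x) (hwb x) (abs_nonneg _) (by positivity))
    rwa [Real.norm_eq_abs, sub_zero, abs_of_pos Real.pi_pos] at this
  have hb : ∀ θ, |u θ * w θ| ≤ A / (δ * s) * (1 / (a * X)) := fun θ => by
    rw [abs_mul]
    exact mul_le_mul (hub θ) (hwb θ) (abs_nonneg _) (by positivity)
  have h1 := hb 0
  have h2 := hb Real.pi
  have h3 := abs_sub (u Real.pi * w Real.pi - u 0 * w 0) (∫ x in (0:ℝ)..Real.pi, u' x * w x)
  have h4 := abs_sub (u Real.pi * w Real.pi) (u 0 * w 0)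
  have : 1 / (a * X) * (2 * (A / (δ * s)) + Real.pi * (A' / (δ * s) + A * X / (δ * s) ^ 2)) =
    A / (δ * s) * (1 / (a * X)) + A / (δ * s) * (1 / (a * X)) +
     (A' / (δ * s) + A * X / (δ * s) ^ 2) * (1 / (a * X)) * Real.pi := by ring
  rw [this]
  linarith

lemma aux_radial (μ κ D : ℝ) (hD : D ≠ 0) :
    ∫ r in μ..κ, Real.cos (r * D) = Real.sin (κ * D) / D - Real.sin (μ * D) / D := by
  have h : ∀ r, HasDerivAt (fun r => Real.sin (r * D) / D) (Real.cos (r * D)) r := by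
    intro r
    have := (((hasDerivAt_id r).mul_const D).sin).div_const D
    refine HasDerivAt.congr_deriv this ?_
    simp [hD]
  exact intervalIntegral.integral_eq_sub_of_hasDerivAt (fun r _ => h r)
    ((by fun_prop : Continuous fun r => Real.cos (r * D)).intervalIntegrable _ _)

/-- the bound for a single meridian half-plane -/
lemma aux_plane (ν δ p q p' q' c X s μ κ ν₀ : ℝ) (hδ : 0 < δ) (hνδ : ν = 1 - δ)
    (hα : ∀ θ, |p * Real.cos θ + q * Real.sin θ| ≤ ν)
    (hβ : ∀ θ, |p' * Real.cos θ + q' * Real.sin θ| ≤ 1) (hc : |c| ≤ 1)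
    (hν₀ : 0 < ν₀) (hs : 0 < s) (hX : ν₀ * s ≤ X) (hX' : X ≤ ν * s) (hμ : 0 < μ) (hμκ : μ ≤ κ) :
    |∫ θ in (0:ℝ)..Real.pi, ∫ r in μ..κ,
      2 * (c - (p * Real.cos θ + q * Real.sin θ) * (p' * Real.cos θ + q' * Real.sin θ)) /
        (1 - (p * Real.cos θ + q * Real.sin θ)) * Real.sin θ *
        Real.cos (r * (X * Real.cos θ - s))| ≤
     2 * (1 / ν₀ * (2 * (4 / δ / δ) + Real.pi * (8 / δ ^ 2 / δ + 4 / δ / δ ^ 2))) / (μ * s ^ 2) := by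
  have hν0 : 0 ≤ ν := (abs_nonneg _).trans (hα 0)
  have hX0 : 0 < X := lt_of_lt_of_le (by positivity) hX
  set α : ℝ → ℝ := fun θ => p * Real.cos θ + q * Real.sin θ with hαd
  set β : ℝ → ℝ := fun θ => p' * Real.cos θ + q' * Real.sin θ with hβd
  have hdα : ∀ θ, HasDerivAt α (α (θ + Real.pi / 2)) θ := by
    intro θ
    have := ((Real.hasDerivAt_cos θ).const_mul p).add ((Real.hasDerivAt_sin θ).const_mul q)
    refine HasDerivAt.congr_deriv this ?_
    simp [hαd, Real.cos_add_pi_div_two, Real.sin_add_pi_div_two]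
  have hdβ : ∀ θ, HasDerivAt β (β (θ + Real.pi / 2)) θ := by
    intro θ
    have := ((Real.hasDerivAt_cos θ).const_mul p').add ((Real.hasDerivAt_sin θ).const_mul q')
    refine HasDerivAt.congr_deriv this ?_
    simp [hβd, Real.cos_add_pi_div_two, Real.sin_add_pi_div_two]
  have hδα : ∀ θ, δ ≤ 1 - α θ := fun θ => by linarith [le_abs_self (α θ), hα θ]
  have hαc : Continuous α := by simp only [hαd]; fun_prop
  have hβc : Continuous β := by simp only [hβd]; fun_prop
  have hne : ∀ θ, 1 - α θ ≠ 0 := fun θ => by linarith [hδα θ]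
  have hαβ : ∀ x y, |α x * β y| ≤ 1 := fun x y => by
    rw [abs_mul]
    have := mul_le_mul (hα x) (hβ y) (abs_nonneg _) hν0
    linarith
  have hδ1 : δ ≤ 1 := by linarith
  set G : ℝ → ℝ := fun θ => 2 * (c - α θ * β θ) / (1 - α θ) with hGd
  set G' : ℝ → ℝ := fun θ => (2 * (-(α (θ + Real.pi / 2) * β θ + α θ * β (θ + Real.pi / 2))) *
    (1 - α θ) - 2 * (c - α θ * β θ) * (-α (θ + Real.pi / 2))) / (1 - α θ) ^ 2 with hG'd
  have hG : ∀ θ, HasDerivAt G (G' θ) θ := fun θ =>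
    ((((hdα θ).mul (hdβ θ)).const_sub c).const_mul 2).div ((hdα θ).const_sub 1) (hne θ)
  have hGc : Continuous G := continuous_iff_continuousAt.2 fun θ => (hG θ).continuousAt
  have hG'c : Continuous G' := by
    simp only [hG'd]
    exact Continuous.div (by fun_prop) (by fun_prop) fun θ => pow_ne_zero _ (hne θ)
  have hN : ∀ θ, |2 * (c - α θ * β θ)| ≤ 4 := fun θ => by
    rw [abs_mul, abs_two]
    linarith [abs_sub c (α θ * β θ), hαβ θ θ]
  have hA : ∀ θ, |G θ| ≤ 4 / δ := by
    intro θ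
    simp only [hGd, abs_div]
    exact div_le_div₀ (by norm_num) (hN θ) hδ ((hδα θ).trans (le_abs_self _))
  have hA' : ∀ θ, |G' θ| ≤ 8 / δ ^ 2 := by
    intro θ
    have h : G' θ = 2 * (-(α (θ + Real.pi / 2) * β θ + α θ * β (θ + Real.pi / 2))) / (1 - α θ)
       + 2 * (c - α θ * β θ) * (α (θ + Real.pi / 2)) / (1 - α θ) ^ 2 := by
      simp only [hG'd]
      have := hne θ
      field_simp
      ring
    have h1 : |2 * (-(α (θ + Real.pi / 2) * β θ + α θ * β (θ + Real.pi / 2))) / (1 - α θ)|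
        ≤ 4 / δ := by
      rw [abs_div]
      refine div_le_div₀ (by norm_num) ?_ hδ ((hδα θ).trans (le_abs_self _))
      rw [abs_mul, abs_two, abs_neg]
      linarith [abs_add_le (α (θ + Real.pi / 2) * β θ) (α θ * β (θ + Real.pi / 2)),
        hαβ (θ + Real.pi / 2) θ, hαβ θ (θ + Real.pi / 2)]
    have h2 : |2 * (c - α θ * β θ) * (α (θ + Real.pi / 2)) / (1 - α θ) ^ 2| ≤ 4 / δ ^ 2 := by
      rw [abs_div, abs_mul]
      refine div_le_div₀ (by norm_num) ?_ (by positivity) ?_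
      · have := mul_le_mul (hN θ) (hα (θ + Real.pi / 2)) (abs_nonneg _) (by norm_num)
        linarith
      · rw [abs_pow]
        exact pow_le_pow_left₀ hδ.le ((hδα θ).trans (le_abs_self _)) 2
    have h3 : 4 / δ ≤ 4 / δ ^ 2 := by
      apply div_le_div_of_nonneg_left (by norm_num) (by positivity)
      nlinarith
    rw [h]
    have : 8 / δ ^ 2 = 4 / δ ^ 2 + 4 / δ ^ 2 := by ring
    linarith [abs_add_le (2 * (-(α (θ + Real.pi / 2) * β θ + α θ * β (θ + Real.pi / 2))) / (1 - α θ))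
      (2 * (c - α θ * β θ) * (α (θ + Real.pi / 2)) / (1 - α θ) ^ 2)]
  have hD0 : ∀ θ, X * Real.cos θ - s ≠ 0 := by
    intro θ h
    have : X * Real.cos θ ≤ X := by nlinarith [Real.cos_le_one θ]
    nlinarith
  have hrw : ∀ θ, (∫ r in μ..κ, G θ * Real.sin θ * Real.cos (r * (X * Real.cos θ - s))) =
      G θ * Real.sin θ * (Real.sin (κ * (X * Real.cos θ - s)) / (X * Real.cos θ - s)) -
      G θ * Real.sin θ * (Real.sin (μ * (X * Real.cos θ - s)) / (X * Real.cos θ - s)) := by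
    intro θ
    rw [intervalIntegral.integral_const_mul, aux_radial _ _ _ (hD0 θ)]
    ring
  have hcont : ∀ a : ℝ, Continuous fun θ => G θ * Real.sin θ *
      (Real.sin (a * (X * Real.cos θ - s)) / (X * Real.cos θ - s)) := fun a =>
    (hGc.mul Real.continuous_sin).mul (Continuous.div (by fun_prop) (by fun_prop) hD0)
  change |∫ θ in (0:ℝ)..Real.pi, ∫ r in μ..κ, G θ * Real.sin θ *
    Real.cos (r * (X * Real.cos θ - s))| ≤ _
  simp_rw [hrw]
  rw [intervalIntegral.integral_sub ((hcont κ).intervalIntegrable _ _)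
    ((hcont μ).intervalIntegrable _ _)]
  have hXs : X ≤ s := by nlinarith
  have hb : ∀ a, μ ≤ a → |∫ θ in (0:ℝ)..Real.pi, G θ * Real.sin θ *
      (Real.sin (a * (X * Real.cos θ - s)) / (X * Real.cos θ - s))| ≤
      (1 / ν₀ * (2 * (4 / δ / δ) + Real.pi * (8 / δ ^ 2 / δ + 4 / δ / δ ^ 2))) / (μ * s ^ 2) := by
    intro a ha
    refine (aux_ibp G G' hG hG'c (4 / δ) (8 / δ ^ 2) X s a δ hA hA' hX0 hs (hμ.trans_le ha) hδ
      (by rw [← hνδ]; exact hX')).trans ?_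
    have hpi := Real.pi_pos
    have ha0 : 0 ≤ a := hμ.le.trans ha
    calc _ ≤ 1 / (μ * (ν₀ * s)) * (2 * (4 / δ / (δ * s)) + Real.pi * (8 / δ ^ 2 / (δ * s) +
            4 / δ * s / (δ * s) ^ 2)) := by gcongr
      _ = _ := by field_simp
  have h1 := hb κ hμκ
  have h2 := hb μ le_rfl
  refine (abs_sub _ _).trans ((add_le_add h1 h2).trans (le_of_eq ?_))
  ring

lemma aux_integrable {α : Type*} [MeasureSpace α] (f : α → ℝ) (hf : Measurable f) (S : Set α)
    (hS : volume S ≠ ⊤) (M : ℝ) (hM : ∀ x, |f x| ≤ M) (h0 : ∀ x, x ∉ S → f x = 0) :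
    Integrable f := by
  have h1 : IntegrableOn f S volume :=
    Measure.integrableOn_of_bounded hS hf.aestronglyMeasurable (M := M)
      (Filter.Eventually.of_forall hM)
  refine (integrableOn_iff_integrable_of_support_subset ?_).1 h1
  intro x hx
  by_contra h
  exact hx (h0 x h)

lemma aux_cyl (H : ℝ × ℝ × ℝ → ℝ) (hH : Measurable H) (M κ B : ℝ) (hκ : 0 < κ)
    (hM : ∀ p, |H p| ≤ M) (hsupp : ∀ p, H p ≠ 0 → |p.1| ≤ κ ∧ p.2.1 ^ 2 + p.2.2 ^ 2 ≤ κ ^ 2)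
    (hB : ∀ φ : ℝ, |∫ q in Set.Ioi (0:ℝ) ×ˢ Set.Ioo (0:ℝ) Real.pi, q.1 ^ 2 * Real.sin q.2 *
      H (q.1 * Real.cos q.2, q.1 * Real.sin q.2 * Real.cos φ,
        q.1 * Real.sin q.2 * Real.sin φ)| ≤ B) :
    |∫ p, H p| ≤ B * (2 * Real.pi) := by
  have hM0 : 0 ≤ M := (abs_nonneg _).trans (hM 0)
  have hHi : Integrable H := by
    refine aux_integrable H hH (Set.Icc (-κ) κ ×ˢ Set.Icc (-κ) κ ×ˢ Set.Icc (-κ) κ) ?_ M hM ?_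
    · exact ((isCompact_Icc).prod (isCompact_Icc.prod isCompact_Icc)).measure_ne_top
    · intro p hp
      by_contra h
      obtain ⟨h1, h2⟩ := hsupp p h
      apply hp
      have h3 : |p.2.1| ≤ κ := abs_le_of_sq_le_sq (by nlinarith [sq_nonneg p.2.2]) hκ.le
      have h4 : |p.2.2| ≤ κ := abs_le_of_sq_le_sq (by nlinarith [sq_nonneg p.2.1]) hκ.le
      exact ⟨abs_le.1 h1, abs_le.1 h3, abs_le.1 h4⟩
  set K : ℝ × ℝ × ℝ → ℝ := fun p => Set.indicator (Set.Ioi (0:ℝ) ×ˢ Set.Ioo (-Real.pi) Real.pi)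
    (fun q : ℝ × ℝ => q.1 * H (p.1, q.1 * Real.cos q.2, q.1 * Real.sin q.2)) p.2 with hK
  have hKeq : ∀ p : ℝ × ℝ × ℝ, K p = Set.indicator
      (Set.univ ×ˢ (Set.Ioi (0:ℝ) ×ˢ Set.Ioo (-Real.pi) Real.pi))
      (fun p : ℝ × ℝ × ℝ => p.2.1 * H (p.1, p.2.1 * Real.cos p.2.2, p.2.1 * Real.sin p.2.2)) p := by
    intro p
    simp [hK, Set.indicator_apply]
  have hKm : Measurable K := by
    rw [show K = _ from funext hKeq]
    refine Measurable.indicator ?_ ?_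
    · exact measurable_snd.fst.mul (hH.comp (by fun_prop))
    · exact MeasurableSet.univ.prod (measurableSet_Ioi.prod measurableSet_Ioo)
  have hKs : ∀ p, K p ≠ 0 → p ∈ Set.Icc (-κ) κ ×ˢ Set.Icc (-κ) κ ×ˢ Set.Icc (-Real.pi) Real.pi
      ∧ |p.2.1| ≤ κ := by
    intro p hp
    rw [hKeq, Set.indicator_apply_ne_zero] at hp
    obtain ⟨⟨-, h1, h2⟩, h3⟩ := hp
    obtain ⟨h4, h5⟩ := hsupp _ (right_ne_zero_of_mul h3)
    have h6 : |p.2.1| ≤ κ := by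
      apply abs_le_of_sq_le_sq _ hκ.le
      have := Real.sin_sq_add_cos_sq p.2.2
      simp only at h5
      nlinarith
    exact ⟨⟨abs_le.1 h4, abs_le.1 h6, Set.Ioo_subset_Icc_self h2⟩, h6⟩
  have hKb : ∀ p, |K p| ≤ κ * M := by
    intro p
    by_cases hp : K p = 0
    · rw [hp, abs_zero]; positivity
    · have h1 := (hKs p hp).2
      rw [hKeq] at hp ⊢
      rw [Set.indicator_of_mem (Set.indicator_apply_ne_zero.1 hp).1, abs_mul]
      exact mul_le_mul h1 (hM _) (abs_nonneg _) hκ.le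
  have hKi : Integrable K := by
    refine aux_integrable K hKm _ ?_ _ hKb (fun x hx => by
      by_contra h
      exact hx (hKs x h).1)
    exact ((isCompact_Icc).prod (isCompact_Icc.prod isCompact_Icc)).measure_ne_top
  have e1 : ∫ p, H p = ∫ p, K p := by
    rw [Measure.volume_eq_prod, integral_prod _ hHi, integral_prod _ hKi]
    congr 1
    ext z
    rw [← integral_comp_polarCoord_symm (fun q => H (z, q)), polarCoord_target,
      ← integral_indicator (measurableSet_Ioi.prod measurableSet_Ioo)]
    rfl
  have hmp := (volume_preserving_prodAssoc (α₁ := ℝ) (β₁ := ℝ) (γ₁ := ℝ))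
  have e2 : ∫ p, K p = ∫ p : (ℝ × ℝ) × ℝ, K (p.1.1, p.1.2, p.2) :=
    (hmp.integral_comp MeasurableEquiv.prodAssoc.measurableEmbedding K).symm
  have hKi2 : Integrable (fun p : (ℝ × ℝ) × ℝ => K (p.1.1, p.1.2, p.2)) :=
    (hmp.integrable_comp_emb MeasurableEquiv.prodAssoc.measurableEmbedding).2 hKi
  have e3 : ∫ p : (ℝ × ℝ) × ℝ, K (p.1.1, p.1.2, p.2) =
      ∫ φ : ℝ, ∫ q : ℝ × ℝ, K (q.1, q.2, φ) := by
    rw [Measure.volume_eq_prod, integral_prod_symm _ hKi2]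
  have e4 : ∀ φ : ℝ, ∫ q : ℝ × ℝ, K (q.1, q.2, φ) =
      Set.indicator (Set.Ioo (-Real.pi) Real.pi) (fun φ =>
        ∫ q in Set.Ioi (0:ℝ) ×ˢ Set.Ioo (0:ℝ) Real.pi, q.1 ^ 2 * Real.sin q.2 *
      H (q.1 * Real.cos q.2, q.1 * Real.sin q.2 * Real.cos φ,
        q.1 * Real.sin q.2 * Real.sin φ)) φ := by
    intro φ
    by_cases hφ : φ ∈ Set.Ioo (-Real.pi) Real.pi
    · rw [Set.indicator_of_mem hφ, ← integral_comp_polarCoord_symm (fun q => K (q.1, q.2, φ)),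
        polarCoord_target, ← integral_indicator (measurableSet_Ioi.prod measurableSet_Ioo),
        ← integral_indicator (measurableSet_Ioi.prod measurableSet_Ioo)]
      congr 1
      ext q
      by_cases hq : q ∈ Set.Ioi (0:ℝ) ×ˢ Set.Ioo (0:ℝ) Real.pi
      · have hq' : q ∈ Set.Ioi (0:ℝ) ×ˢ Set.Ioo (-Real.pi) Real.pi :=
          ⟨hq.1, by linarith [hq.2.1, Real.pi_pos], hq.2.2⟩
        rw [Set.indicator_of_mem hq, Set.indicator_of_mem hq']
        have hpos : 0 < q.1 * Real.sin q.2 :=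
          mul_pos hq.1 (Real.sin_pos_of_pos_of_lt_pi hq.2.1 hq.2.2)
        simp only [hK, polarCoord_symm_apply]
        rw [Set.indicator_of_mem (show (q.1 * Real.sin q.2, φ) ∈
          Set.Ioi (0:ℝ) ×ˢ Set.Ioo (-Real.pi) Real.pi from ⟨hpos, hφ⟩), smul_eq_mul]
        ring
      · rw [Set.indicator_of_notMem hq]
        by_cases hq' : q ∈ Set.Ioi (0:ℝ) ×ˢ Set.Ioo (-Real.pi) Real.pi
        · rw [Set.indicator_of_mem hq']
          have hle : q.2 ≤ 0 := by
            by_contra h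
            exact hq ⟨hq'.1, not_le.1 h, hq'.2.2⟩
          have : q.1 * Real.sin q.2 ≤ 0 := mul_nonpos_of_nonneg_of_nonpos (le_of_lt hq'.1)
            (Real.sin_nonpos_of_nonpos_of_neg_pi_le hle hq'.2.1.le)
          simp only [hK, polarCoord_symm_apply]
          rw [Set.indicator_of_notMem, smul_zero]
          intro h
          exact absurd h.1 (not_lt.2 this)
        · rw [Set.indicator_of_notMem hq']
    · rw [Set.indicator_of_notMem hφ]
      have : ∀ q : ℝ × ℝ, K (q.1, q.2, φ) = 0 := by
        intro q
        simp only [hK]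
        exact Set.indicator_of_notMem (fun h => hφ h.2) _
      simp [this]
  rw [e1, e2, e3]
  simp_rw [e4]
  rw [integral_indicator measurableSet_Ioo]
  have := norm_setIntegral_le_of_norm_le_const (μ := volume) (s := Set.Ioo (-Real.pi) Real.pi) (C := B)
    (f := fun φ => ∫ q in Set.Ioi (0:ℝ) ×ˢ Set.Ioo (0:ℝ) Real.pi, q.1 ^ 2 * Real.sin q.2 *
      H (q.1 * Real.cos q.2, q.1 * Real.sin q.2 * Real.cos φ,
        q.1 * Real.sin q.2 * Real.sin φ)) (by simp) (fun φ _ => hB φ)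
  rw [Real.norm_eq_abs, Real.volume_real_Ioo_of_le (by linarith [Real.pi_pos])] at this
  convert this using 2
  ring

/-- The coordinates adapted to an orthonormal basis. -/
lemma aux_coord (b : OrthonormalBasis (Fin 3) ℝ E3) (F : E3 → ℝ) :
    ∫ k, F k = ∫ p : ℝ × ℝ × ℝ, F (p.1 • b 0 + p.2.1 • b 1 + p.2.2 • b 2) := by
  have m1 := b.measurePreserving_measurableEquiv.symm
  have m2 := (EuclideanSpace.volume_preserving_symm_measurableEquiv_toLp (Fin 3)).symm
  have m3 := (volume_preserving_piFinSuccAbove (fun _ : Fin 3 => ℝ) 0).symm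
  have m4 : MeasurePreserving (Prod.map (id : ℝ → ℝ) (MeasurableEquiv.finTwoArrow (α := ℝ)).symm)
      (volume : Measure (ℝ × ℝ × ℝ)) volume :=
    (MeasurePreserving.id volume).prod (volume_preserving_finTwoArrow ℝ).symm
  have m5 : MeasurableEmbedding
      (Prod.map (id : ℝ → ℝ) (MeasurableEquiv.finTwoArrow (α := ℝ)).symm) :=
    ((MeasurableEquiv.refl ℝ).prodCongr
      (MeasurableEquiv.finTwoArrow (α := ℝ)).symm).measurableEmbedding
  rw [← m1.integral_comp (MeasurableEquiv.measurableEmbedding _) F,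
    ← m2.integral_comp (MeasurableEquiv.measurableEmbedding _),
    ← m3.integral_comp (MeasurableEquiv.measurableEmbedding _), ← m4.integral_comp m5]
  congr 1
  ext p
  congr 1
  change b.repr.symm _ = _
  rw [← b.sum_repr_symm, Fin.sum_univ_three]
  rfl

lemma aux_swap (Φ : ℝ → ℝ → ℝ) (hΦ : Continuous fun q : ℝ × ℝ => Φ q.1 q.2) (μ κ : ℝ)
    (hμκ : μ ≤ κ) :
    ∫ q in Set.Icc μ κ ×ˢ Set.Ioo (0:ℝ) Real.pi, Φ q.1 q.2 =
      ∫ θ in (0:ℝ)..Real.pi, ∫ r in μ..κ, Φ r θ := by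
  have h1 := setIntegral_prod_swap (μ := (volume : Measure ℝ)) (ν := (volume : Measure ℝ))
    (Set.Icc μ κ) (Set.Ioo (0:ℝ) Real.pi) (fun q : ℝ × ℝ => Φ q.1 q.2)
  rw [Measure.volume_eq_prod, ← h1]
  simp only [Prod.fst_swap, Prod.snd_swap]
  have hc : Continuous fun z : ℝ × ℝ => Φ z.2 z.1 := hΦ.comp continuous_swap
  rw [setIntegral_prod]
  · simp only
    rw [intervalIntegral.integral_of_le Real.pi_pos.le, integral_Ioc_eq_integral_Ioo]
    simp_rw [intervalIntegral.integral_of_le hμκ, integral_Icc_eq_integral_Ioc]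
  · exact (hc.continuousOn.integrableOn_compact (isCompact_Icc.prod isCompact_Icc)).mono_set
      (Set.prod_mono Set.Ioo_subset_Icc_self (subset_refl (Set.Icc μ κ)))

lemma aux_basis (x : E3) (hx : x ≠ 0) :
    ∃ b : OrthonormalBasis (Fin 3) ℝ E3, b 0 = ‖x‖⁻¹ • x := by
  have h : Orthonormal ℝ (Set.domRestrict ({0} : Set (Fin 3)) (fun _ : Fin 3 => ‖x‖⁻¹ • x)) := by
    constructor
    · intro i
      change ‖‖x‖⁻¹ • x‖ = 1
      simp [norm_smul, hx]
    · intro i j hij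
      exact absurd (Subsingleton.elim i j) hij
  obtain ⟨b, hb⟩ := h.exists_orthonormalBasis_extension_of_card_eq (by simp)
  exact ⟨b, hb 0 rfl⟩

lemma aux_Sig_apply (v k : E3) (l : Fin 3) : (Sig v k) l =
    (2 / (‖k‖ ^ 2 * (1 - ⟪k, v⟫ / ‖k‖))) * (v l - (⟪k, v⟫ / ‖k‖ ^ 2) * k l) := by
  simp [Sig]

/-- in polar form -/
lemma aux_Sig_polar (v ω : E3) (hω : ‖ω‖ = 1) (r : ℝ) (hr : 0 < r) (l : Fin 3) :
    r ^ 2 * (Sig v (r • ω)) l = 2 * (v l - ⟪ω, v⟫ * ω l) / (1 - ⟪ω, v⟫) := by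
  rw [aux_Sig_apply]
  have hn : ‖r • ω‖ = r := by rw [norm_smul, hω, mul_one, Real.norm_eq_abs, abs_of_pos hr]
  rw [hn, real_inner_smul_left]
  have e1 : r * ⟪ω, v⟫ / r = ⟪ω, v⟫ := by field_simp
  have e2 : r * ⟪ω, v⟫ / r ^ 2 * (r • ω) l = ⟪ω, v⟫ * ω l := by
    simp only [PiLp.smul_apply, smul_eq_mul]; field_simp
  rw [e1, e2]
  by_cases h : 1 - ⟪ω, v⟫ = 0
  · simp [h]
  · field_simp

lemma aux_coord_le (v : E3) (l : Fin 3) : |v l| ≤ ‖v‖ := by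
  simpa using PiLp.norm_apply_le v l

lemma aux_Sig_bound (v k : E3) (μ δ : ℝ) (hμ : 0 < μ) (hδ : 0 < δ) (hv : ‖v‖ ≤ 1 - δ)
    (hk : μ ≤ ‖k‖) (l : Fin 3) : |(Sig v k) l| ≤ 4 / δ / μ ^ 2 := by
  have hk0 : 0 < ‖k‖ := hμ.trans_le hk
  set ω : E3 := ‖k‖⁻¹ • k with hωd
  have hω : ‖ω‖ = 1 := by
    rw [hωd, norm_smul, norm_inv, norm_norm]; field_simp
  have hkω : ‖k‖ • ω = k := by rw [hωd, smul_smul, mul_inv_cancel₀ hk0.ne', one_smul]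
  have h := aux_Sig_polar v ω hω ‖k‖ hk0 l
  rw [hkω] at h
  have hi : |⟪ω, v⟫| ≤ 1 - δ := by
    have := abs_real_inner_le_norm ω v
    rw [hω, one_mul] at this
    linarith
  have h1 : δ ≤ 1 - ⟪ω, v⟫ := by linarith [le_abs_self ⟪ω, v⟫]
  have h2 : |2 * (v l - ⟪ω, v⟫ * ω l) / (1 - ⟪ω, v⟫)| ≤ 4 / δ := by
    rw [abs_div]
    refine div_le_div₀ (by norm_num) ?_ hδ (h1.trans (le_abs_self _))
    rw [abs_mul, abs_two]
    have h3 := aux_coord_le v l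
    have h4 := aux_coord_le ω l
    have h5 : |⟪ω, v⟫ * ω l| ≤ 1 := by
      rw [abs_mul]
      have := mul_le_mul hi h4 (abs_nonneg _) ((abs_nonneg _).trans hi)
      rw [hω] at this
      linarith
    linarith [abs_sub (v l) (⟪ω, v⟫ * ω l)]
  rw [← h, abs_mul, abs_of_pos (by positivity)] at h2
  rw [le_div_iff₀ (by positivity)]
  refine le_trans ?_ h2
  rw [mul_comm]
  gcongr

/-- Lemma A.2, second estimate: improved decay `C/(μ s²)` inside the light-cone shell
`ν_min s ≤ |x| ≤ ν_max s`, uniformly in the infrared cutoff μ. -/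
theorem statement1 (νmin νmax κ : ℝ) (h0 : 0 < νmin) (h1 : νmin ≤ νmax) (h2 : νmax < 1)
    (hκ : 0 < κ) :
    ∃ C : ℝ, ∀ v : E3, ‖v‖ ≤ νmax → ∀ μ : ℝ, 0 < μ → μ ≤ κ →
      ∀ s : ℝ, 0 < s → ∀ x : E3, νmin * s ≤ ‖x‖ → ‖x‖ ≤ νmax * s → ∀ l : Fin 3,
      |∫ k in annulus μ κ, (Sig v k) l * Real.cos (⟪k, x⟫ - ‖k‖ * s)| ≤
        C / (μ * s ^ 2) := by
  set δ := 1 - νmax with hδd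
  have hδ : 0 < δ := by linarith
  refine ⟨2 * (1 / νmin * (2 * (4 / δ / δ) + Real.pi * (8 / δ ^ 2 / δ + 4 / δ / δ ^ 2))) *
    (2 * Real.pi), ?_⟩
  intro v hv μ hμ hμκ s hs x hx1 hx2 l
  have hX0 : 0 < ‖x‖ := lt_of_lt_of_le (by positivity) hx1
  obtain ⟨b, hb⟩ := aux_basis x (norm_pos_iff.1 hX0)
  have hms : MeasurableSet (annulus μ κ) :=
    (measurableSet_le measurable_const measurable_norm).inter
      (measurableSet_le measurable_norm measurable_const)
  set F : E3 → ℝ := (annulus μ κ).indicator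
    (fun k => (Sig v k) l * Real.cos (⟪k, x⟫ - ‖k‖ * s)) with hF
  have hFm : Measurable F := by
    refine Measurable.indicator ?_ hms
    simp_rw [aux_Sig_apply]
    fun_prop
  have hFb : ∀ k, |F k| ≤ 4 / δ / μ ^ 2 := by
    intro k
    by_cases hk : k ∈ annulus μ κ
    · rw [hF, Set.indicator_of_mem hk, abs_mul]
      have h1 := aux_Sig_bound v k μ δ hμ hδ (by linarith) hk.1 l
      have h2 := Real.abs_cos_le_one (⟪k, x⟫ - ‖k‖ * s)
      have := mul_le_mul h1 h2 (abs_nonneg _) (by positivity)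
      linarith
    · rw [hF, Set.indicator_of_notMem hk, abs_zero]; positivity
  have hon : ∀ i j, ⟪b i, b j⟫ = if i = j then (1:ℝ) else 0 :=
    orthonormal_iff_ite.1 b.orthonormal
  have hnorm : ∀ a c d : ℝ, ‖a • b 0 + c • b 1 + d • b 2‖ ^ 2 = a ^ 2 + c ^ 2 + d ^ 2 := by
    intro a c d
    rw [← real_inner_self_eq_norm_sq]
    simp only [inner_add_left, inner_add_right, real_inner_smul_left, real_inner_smul_right, hon]
    simp
    ring
  rw [← integral_indicator hms]
  change |∫ k, F k| ≤ _
  rw [aux_coord b F]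
  have := aux_cyl (fun p => F (p.1 • b 0 + p.2.1 • b 1 + p.2.2 • b 2))
    (hFm.comp (by fun_prop)) (4 / δ / μ ^ 2) κ
    (2 * (1 / νmin * (2 * (4 / δ / δ) + Real.pi * (8 / δ ^ 2 / δ + 4 / δ / δ ^ 2))) / (μ * s ^ 2))
    hκ (fun p => hFb _) ?_ ?_
  · refine this.trans (le_of_eq ?_)
    ring
  · intro p hp
    have hk := (Set.indicator_apply_ne_zero.1 hp).1
    have h1 := hnorm p.1 p.2.1 p.2.2
    have h2 := pow_le_pow_left₀ (norm_nonneg _) hk.2 2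
    rw [h1] at h2
    refine ⟨abs_le_of_sq_le_sq ?_ hκ.le, ?_⟩
    · nlinarith [sq_nonneg p.2.1, sq_nonneg p.2.2]
    · nlinarith [sq_nonneg p.1]
  · intro φ
    set f : E3 := Real.cos φ • b 1 + Real.sin φ • b 2 with hf
    set ω : ℝ → E3 := fun θ => Real.cos θ • b 0 + Real.sin θ • f with hωd
    have hω : ∀ θ, ‖ω θ‖ = 1 := by
      intro θ
      have h1 : ω θ = Real.cos θ • b 0 + (Real.sin θ * Real.cos φ) • b 1 +
          (Real.sin θ * Real.sin φ) • b 2 := by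
        simp only [hωd, hf, smul_add, smul_smul, add_assoc]
      have h2 : ‖ω θ‖ ^ 2 = 1 := by
        rw [h1, hnorm]
        have := Real.sin_sq_add_cos_sq θ
        have := Real.sin_sq_add_cos_sq φ
        calc _ = Real.cos θ ^ 2 + Real.sin θ ^ 2 * (Real.sin φ ^ 2 + Real.cos φ ^ 2) := by ring
          _ = 1 := by rw [this]; linarith
      exact (pow_eq_one_iff_of_nonneg (norm_nonneg _) two_ne_zero).1 h2
    have hωv : ∀ θ, ⟪ω θ, v⟫ = ⟪b 0, v⟫ * Real.cos θ + ⟪f, v⟫ * Real.sin θ := by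
      intro θ
      simp only [hωd, inner_add_left, real_inner_smul_left]
      ring
    have hωl : ∀ θ, ω θ l = b 0 l * Real.cos θ + f l * Real.sin θ := by
      intro θ
      simp only [hωd, PiLp.add_apply, PiLp.smul_apply, smul_eq_mul]
      ring
    have hxb : x = ‖x‖ • b 0 := by
      rw [hb, smul_smul, mul_inv_cancel₀ hX0.ne', one_smul]
    have hωx : ∀ θ, ⟪ω θ, x⟫ = ‖x‖ * Real.cos θ := by
      intro θ
      conv_lhs => rw [hxb]
      simp only [hωd, hf, inner_add_left, real_inner_smul_left, real_inner_smul_right, hon]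
      simp
    have hα : ∀ θ, |⟪b 0, v⟫ * Real.cos θ + ⟪f, v⟫ * Real.sin θ| ≤ νmax := by
      intro θ
      rw [← hωv]
      have := abs_real_inner_le_norm (ω θ) v
      rw [hω, one_mul] at this
      linarith
    have hβ : ∀ θ, |b 0 l * Real.cos θ + f l * Real.sin θ| ≤ 1 := by
      intro θ
      rw [← hωl, ← hω θ]
      exact aux_coord_le _ _
    have hpl := aux_plane νmax δ ⟪b 0, v⟫ ⟪f, v⟫ (b 0 l) (f l) (v l) ‖x‖ s μ κ νmin hδ
      (by linarith) hα hβ ((aux_coord_le v l).trans (by linarith)) h0 hs hx1 hx2 hμ hμκ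
    refine le_trans (le_of_eq ?_) hpl
    congr 1
    rw [← aux_swap (fun r θ => 2 * (v l - (⟪b 0, v⟫ * Real.cos θ + ⟪f, v⟫ * Real.sin θ) *
      (b 0 l * Real.cos θ + f l * Real.sin θ)) /
        (1 - (⟪b 0, v⟫ * Real.cos θ + ⟪f, v⟫ * Real.sin θ)) * Real.sin θ *
        Real.cos (r * (‖x‖ * Real.cos θ - s))) ?_ μ κ hμκ]
    · rw [← integral_indicator (measurableSet_Ioi.prod measurableSet_Ioo),
        ← integral_indicator (measurableSet_Icc.prod measurableSet_Ioo)]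
      congr 1
      ext q
      by_cases hq : q ∈ Set.Ioi (0:ℝ) ×ˢ Set.Ioo (0:ℝ) Real.pi
      · rw [Set.indicator_of_mem hq]
        have hr : 0 < q.1 := hq.1
        have hk : (q.1 * Real.cos q.2) • b 0 + (q.1 * Real.sin q.2 * Real.cos φ) • b 1 +
            (q.1 * Real.sin q.2 * Real.sin φ) • b 2 = q.1 • ω q.2 := by
          simp only [hωd, hf, smul_add, smul_smul, add_assoc, mul_assoc]
        have hn : ‖q.1 • ω q.2‖ = q.1 := by
          rw [norm_smul, hω, mul_one, Real.norm_eq_abs, abs_of_pos hr]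
        simp only [hk]
        by_cases hq1 : q.1 ∈ Set.Icc μ κ
        · rw [Set.indicator_of_mem (show q ∈ Set.Icc μ κ ×ˢ Set.Ioo (0:ℝ) Real.pi from ⟨hq1, hq.2⟩)]
          rw [hF, Set.indicator_of_mem (show q.1 • ω q.2 ∈ annulus μ κ by
            simp only [annulus, Set.mem_ofPred_eq, hn]; exact hq1)]
          have h1 := aux_Sig_polar v (ω q.2) (hω _) q.1 hr l
          rw [hωv, hωl] at h1
          rw [← h1, hn, real_inner_smul_left, hωx]
          have : q.1 * (‖x‖ * Real.cos q.2) - q.1 * s = q.1 * (‖x‖ * Real.cos q.2 - s) := by ring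
          rw [this]
          ring
        · rw [Set.indicator_of_notMem (fun h => hq1 h.1), hF, Set.indicator_of_notMem, mul_zero]
          intro h
          simp only [annulus, Set.mem_ofPred_eq, hn] at h
          exact hq1 h
      · rw [Set.indicator_of_notMem hq, Set.indicator_of_notMem]
        intro h
        exact hq ⟨hμ.trans_le h.1.1, h.2⟩
    · have hne : ∀ q : ℝ × ℝ, 1 - (⟪b 0, v⟫ * Real.cos q.2 + ⟪f, v⟫ * Real.sin q.2) ≠ 0 := by
        intro q
        have := hα q.2
        have := le_abs_self (⟪b 0, v⟫ * Real.cos q.2 + ⟪f, v⟫ * Real.sin q.2)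
        linarith
      exact ((Continuous.div (by fun_prop) (by fun_prop) hne).mul (by fun_prop)).mul (by fun_prop)
end
end

section
/- Let 0 < ν < 1 and κ > 0. There exists a constant C = C(ν, κ) such that for every v ∈ ℝ³ with |v| ≤ ν, every σ with 0 < σ < κ, every s ≥ 0, every x ∈ ℝ³ with x ≠ 0, and every component index l ∈ {1,2,3}, one has |∫_{A(σ,κ)} (Σ_v(k))_l · cos(k·x − |k| s) dk| ≤ C (1 + |log σ|) / |x|. -/
open MeasureTheory
open scoped RealInnerProductSpace

noncomputable section

open Real in
lemma spherical_lintegral (f : ℝ × ℝ × ℝ → ENNReal) (hf : Measurable f) :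
    ∫⁻ y, f y = ∫⁻ φ in Set.Ioo (-π) π, ∫⁻ r in Set.Ioi (0:ℝ), ∫⁻ θ in Set.Ioo 0 π,
      ENNReal.ofReal (r ^ 2 * sin θ) *
        f (r * cos θ, (r * sin θ * cos φ, r * sin θ * sin φ)) := by
  have hpolar : ∀ g : ℝ × ℝ → ENNReal, Measurable g → ∫⁻ p, g p =
      ∫⁻ φ in Set.Ioo (-π) π, ∫⁻ r in Set.Ioi (0:ℝ),
        ENNReal.ofReal r * g (r * cos φ, r * sin φ) := by
    intro g hg
    rw [← lintegral_comp_polarCoord_symm, polarCoord_target, Measure.volume_eq_prod,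
      ← Measure.prod_restrict, lintegral_prod_symm']
    · rfl
    · have := hg.comp continuous_polarCoord_symm.measurable
      exact (ENNReal.measurable_ofReal.comp measurable_fst).smul this
  have hpolar2 : ∀ g : ℝ × ℝ → ENNReal, Measurable g → ∫⁻ p, g p =
      ∫⁻ r in Set.Ioi (0:ℝ), ∫⁻ φ in Set.Ioo (-π) π,
        ENNReal.ofReal r * g (r * cos φ, r * sin φ) := by
    intro g hg
    rw [hpolar g hg, lintegral_lintegral_swap]
    apply Measurable.aemeasurable
    simp only [Function.uncurry_def]
    fun_prop
  calc ∫⁻ y, f y = ∫⁻ z, ∫⁻ p : ℝ × ℝ, f (z, p) := by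
        rw [Measure.volume_eq_prod, lintegral_prod _ hf.aemeasurable]
    _ = ∫⁻ z, ∫⁻ φ in Set.Ioo (-π) π, ∫⁻ ρ in Set.Ioi (0:ℝ),
        ENNReal.ofReal ρ * f (z, (ρ * cos φ, ρ * sin φ)) := by
        congr 1 with z
        exact hpolar _ (by fun_prop)
    _ = ∫⁻ φ in Set.Ioo (-π) π, ∫⁻ z, ∫⁻ ρ in Set.Ioi (0:ℝ),
        ENNReal.ofReal ρ * f (z, (ρ * cos φ, ρ * sin φ)) := by
        rw [lintegral_lintegral_swap]
        apply Measurable.aemeasurable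
        simp only [Function.uncurry_def]
        apply Measurable.lintegral_prod_right' (f := fun q : (ℝ × ℝ) × ℝ =>
          ENNReal.ofReal q.2 * f (q.1.1, (q.2 * cos q.1.2, q.2 * sin q.1.2)))
        fun_prop
    _ = _ := by
        congr 1 with φ
        have hm : Measurable (fun p : ℝ × ℝ => (Set.Ioi (0:ℝ)).indicator
            (fun _ => ENNReal.ofReal p.2 * f (p.1, (p.2 * cos φ, p.2 * sin φ))) p.2) := by
          simp only [Set.indicator_apply]
          refine Measurable.ite (measurableSet_Ioi.preimage measurable_snd) (by fun_prop) (by fun_prop)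
        calc _ = ∫⁻ z, ∫⁻ ρ, (fun p : ℝ × ℝ => (Set.Ioi (0:ℝ)).indicator
            (fun _ => ENNReal.ofReal p.2 * f (p.1, (p.2 * cos φ, p.2 * sin φ))) p.2) (z, ρ) := by
              congr 1 with z
              rw [← lintegral_indicator measurableSet_Ioi]
              rfl
          _ = ∫⁻ p : ℝ × ℝ, (fun p : ℝ × ℝ => (Set.Ioi (0:ℝ)).indicator
            (fun _ => ENNReal.ofReal p.2 * f (p.1, (p.2 * cos φ, p.2 * sin φ))) p.2) p := by
              rw [Measure.volume_eq_prod, lintegral_prod _ hm.aemeasurable]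
          _ = _ := by
              rw [hpolar2 _ hm]
              refine setLIntegral_congr_fun measurableSet_Ioi ?_
              intro r hr
              have hr : 0 < r := hr
              dsimp only
              rw [← lintegral_indicator measurableSet_Ioo, ← lintegral_indicator measurableSet_Ioo]
              congr 1 with θ
              simp only [Set.indicator_apply, Set.mem_Ioi, Set.mem_Ioo]
              by_cases h1 : 0 < θ ∧ θ < π
              · have hs := sin_pos_of_pos_of_lt_pi h1.1 h1.2
                rw [if_pos ⟨by linarith [pi_pos], h1.2⟩, if_pos (by positivity), if_pos h1,
                  ← mul_assoc, ← ENNReal.ofReal_mul hr.le]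
                congr 2
                ring
              · rw [if_neg h1]
                split_ifs with h2 h3
                · exfalso
                  have hs : 0 < sin θ := by
                    by_contra h; push Not at h
                    exact absurd h3 (not_lt.mpr (mul_nonpos_of_nonneg_of_nonpos hr.le h))
                  have : ¬ 0 < θ := fun h => h1 ⟨h, h2.2⟩
                  have := sin_nonpos_of_nonpos_of_neg_pi_le (not_lt.mp this) h2.1.le
                  linarith
                · simp
                · rfl


open Real in
lemma spherical_integral (b : OrthonormalBasis (Fin 3) ℝ E3) (F : E3 → ℝ)
    (hF : Integrable F) :
    Integrable (fun q : (ℝ × ℝ) × ℝ => (q.1.2 ^ 2 * sin q.2) *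
        F (q.1.2 • (cos q.2 • b 0 + sin q.2 • (cos q.1.1 • b 1 + sin q.1.1 • b 2))))
      (((volume.restrict (Set.Ioo (-π) π)).prod (volume.restrict (Set.Ioi (0:ℝ)))).prod
        (volume.restrict (Set.Ioo 0 π))) ∧
    ∫ k, F k = ∫ q : (ℝ × ℝ) × ℝ, (q.1.2 ^ 2 * sin q.2) *
        F (q.1.2 • (cos q.2 • b 0 + sin q.2 • (cos q.1.1 • b 1 + sin q.1.1 • b 2)))
      ∂(((volume.restrict (Set.Ioo (-π) π)).prod (volume.restrict (Set.Ioi (0:ℝ)))).prod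
        (volume.restrict (Set.Ioo 0 π))) := by
  set μ := (((volume : Measure ℝ).restrict (Set.Ioo (-π) π)).prod
    ((volume : Measure ℝ).restrict (Set.Ioi (0:ℝ)))).prod
        ((volume : Measure ℝ).restrict (Set.Ioo 0 π)) with hμ
  set Ψ : (ℝ × ℝ) × ℝ → E3 := fun q =>
    q.1.2 • (cos q.2 • b 0 + sin q.2 • (cos q.1.1 • b 1 + sin q.1.1 • b 2)) with hΨ
  have hΨm : Measurable Ψ := by
    apply Continuous.measurable
    fun_prop
  set d : (ℝ × ℝ) × ℝ → ENNReal := fun q => ENNReal.ofReal (q.1.2 ^ 2 * sin q.2) with hd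
  have hdm : Measurable d := by fun_prop
  have hdpos : ∀ᵐ q ∂μ, 0 ≤ q.1.2 ^ 2 * sin q.2 := by
    have h : ∀ᵐ θ ∂((volume : Measure ℝ).restrict (Set.Ioo 0 π)), 0 ≤ sin θ := by
      filter_upwards [ae_restrict_mem measurableSet_Ioo] with θ hθ
      exact (sin_pos_of_pos_of_lt_pi hθ.1 hθ.2).le
    have := Measure.quasiMeasurePreserving_snd (μ := ((volume : Measure ℝ).restrict
      (Set.Ioo (-π) π)).prod ((volume : Measure ℝ).restrict (Set.Ioi (0:ℝ)))) |>.ae h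
    filter_upwards [this] with q hq
    positivity
  have hJ : MeasurePreserving (fun y : ℝ × ℝ × ℝ => y.1 • b 0 + y.2.1 • b 1 + y.2.2 • b 2) := by
    have h1 := b.measurePreserving_repr_symm.comp (PiLp.volume_preserving_toLp (Fin 3))
    have h2 := (volume_preserving_piFinSuccAbove (fun _ : Fin 3 => ℝ) 0).symm
    have h3 := (MeasurePreserving.id (volume : Measure ℝ)).prod
      (volume_preserving_finTwoArrow ℝ).symm
    have h4 := (h1.comp h2).comp h3
    have heq : (fun y : ℝ × ℝ × ℝ => y.1 • b 0 + y.2.1 • b 1 + y.2.2 • b 2) =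
        ((b.repr.symm ∘ WithLp.toLp 2) ∘ (MeasurableEquiv.piFinSuccAbove (fun _ : Fin 3 => ℝ) 0).symm)
          ∘ Prod.map id MeasurableEquiv.finTwoArrow.symm := by
      funext y
      simp [← b.sum_repr_symm, Fin.sum_univ_three, MeasurableEquiv.piFinSuccAbove]
    rw [heq]
    exact h4
  have hvol : (volume : Measure E3) = (μ.withDensity d).map Ψ := by
    refine Measure.ext_of_lintegral _ fun f hf => ?_
    have hdd := lintegral_withDensity_eq_lintegral_mul μ hdm (hf.comp hΨm)
    simp only [Function.comp_apply] at hdd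
    rw [lintegral_map hf hΨm, hdd,
      ← hJ.lintegral_comp hf,
      spherical_lintegral (fun y => f (y.1 • b 0 + y.2.1 • b 1 + y.2.2 • b 2))
        (hf.comp hJ.measurable), hμ, lintegral_prod,
      lintegral_prod]
    · simp only [hd, hΨ, Pi.mul_apply]
      congr! 7
      simp only [smul_add, smul_smul, mul_assoc, add_assoc, Function.comp_apply]
    · apply Measurable.aemeasurable
      exact Measurable.lintegral_prod_right' (hdm.mul (hf.comp hΨm))
    · exact (hdm.mul (hf.comp hΨm)).aemeasurable
  rw [hvol] at hF
  have hF2 := (integrable_map_measure hF.1 hΨm.aemeasurable).1 hF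
  rw [integrable_withDensity_iff_integrable_smul' hdm (by simp [hd])] at hF2
  have hae : (fun q => (d q).toReal • (F ∘ Ψ) q) =ᵐ[μ]
      fun q => (q.1.2 ^ 2 * sin q.2) * F (Ψ q) := by
    filter_upwards [hdpos] with q hq
    simp [hd, ENNReal.toReal_ofReal hq]
  refine ⟨hF2.congr hae, ?_⟩
  rw [hvol, integral_map hΨm.aemeasurable hF.1,
    integral_withDensity_eq_integral_toReal_smul hdm (by simp [hd])]
  exact integral_congr_ae hae


open Real in
lemma theta_bound (ν : ℝ) (hν1 : ν < 1) (v e w : E3) (hv : ‖v‖ ≤ ν)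
    (he : ‖e‖ = 1) (hw : ‖w‖ = 1) (hew : ⟪e, w⟫ = 0) (l : Fin 3) (R A : ℝ) (hR : 0 < R) :
    |∫ θ in (0:ℝ)..π, (2 / (1 - ⟪cos θ • e + sin θ • w, v⟫) *
        (v l - ⟪cos θ • e + sin θ • w, v⟫ * (cos θ • e + sin θ • w) l)) *
        (sin θ * cos (R * cos θ - A))| ≤
      (8 / (1 - ν) + π * (4 / (1 - ν) ^ 2 + 4 / (1 - ν))) / R := by
  have hν' : 0 < 1 - ν := by linarith
  have hv1 : ‖v‖ ≤ 1 := by linarith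
  have hunit : ∀ c s : ℝ, c ^ 2 + s ^ 2 = 1 → ‖c • e + s • w‖ = 1 := by
    intro c s h
    have : ‖c • e + s • w‖ ^ 2 = 1 := by
      rw [norm_add_sq_real, inner_smul_left, inner_smul_right, hew, norm_smul, norm_smul, he, hw]
      simp [h]
    nlinarith [norm_nonneg (c • e + s • w)]
  have hinner : ∀ y : E3, ‖y‖ = 1 → |⟪y, v⟫| ≤ ν := by
    intro y hy
    have := abs_real_inner_le_norm y v
    rw [hy, one_mul] at this
    linarith
  have hcoord : ∀ y : E3, |y l| ≤ ‖y‖ := fun y => PiLp.norm_apply_le y l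
  set a : ℝ → ℝ := fun θ => ⟪cos θ • e + sin θ • w, v⟫ with ha
  set a' : ℝ → ℝ := fun θ => ⟪(-sin θ) • e + cos θ • w, v⟫ with ha'
  set m : ℝ → ℝ := fun θ => (cos θ • e + sin θ • w) l with hm
  set m' : ℝ → ℝ := fun θ => ((-sin θ) • e + cos θ • w) l with hm'
  have hab : ∀ θ, |a θ| ≤ ν := fun θ => hinner _ (hunit _ _ (by simp))
  have ha'b : ∀ θ, |a' θ| ≤ ν := fun θ => hinner _ (hunit _ _ (by simp))
  have hmb : ∀ θ, |m θ| ≤ 1 := fun θ => (hcoord _).trans (hunit _ _ (by simp)).le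
  have hm'b : ∀ θ, |m' θ| ≤ 1 := fun θ => (hcoord _).trans (hunit _ _ (by simp)).le
  have hvl : |v l| ≤ 1 := (hcoord v).trans hv1
  have hda : ∀ θ, HasDerivAt a (a' θ) θ := by
    intro θ
    have h1 : a = fun θ => cos θ * ⟪e, v⟫ + sin θ * ⟪w, v⟫ := by
      funext t; simp only [ha, inner_add_left, real_inner_smul_left]
    have h2 : a' θ = -sin θ * ⟪e, v⟫ + cos θ * ⟪w, v⟫ := by
      simp only [ha', inner_add_left, real_inner_smul_left]
    rw [h1, h2]
    exact ((hasDerivAt_cos θ).mul_const _).add ((hasDerivAt_sin θ).mul_const _)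
  have hdm : ∀ θ, HasDerivAt m (m' θ) θ := by
    intro θ
    have h1 : m = fun θ => cos θ * e l + sin θ * w l := by
      funext t; simp [hm]
    have h2 : m' θ = -sin θ * e l + cos θ * w l := by
      simp [hm']
    rw [h1, h2]
    exact ((hasDerivAt_cos θ).mul_const _).add ((hasDerivAt_sin θ).mul_const _)
  have hpos : ∀ θ, 1 - ν ≤ 1 - a θ := fun θ => by linarith [le_of_abs_le (hab θ)]
  have hpos' : ∀ θ, 0 < 1 - a θ := fun θ => lt_of_lt_of_le hν' (hpos θ)
  have hac : Continuous a := by fun_prop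
  have ha'c : Continuous a' := by fun_prop
  have hmc : Continuous m := continuous_iff_continuousAt.2 fun θ => (hdm θ).continuousAt
  have hm'c : Continuous m' := by
    have h2 : m' = fun θ => -sin θ * e l + cos θ * w l := by
      funext t; simp [hm']
    rw [h2]; fun_prop
  set h : ℝ → ℝ := fun θ => 2 / (1 - a θ) * (v l - a θ * m θ) with hh
  set h' : ℝ → ℝ := fun θ => 2 * a' θ / (1 - a θ) ^ 2 * (v l - a θ * m θ) +
    2 / (1 - a θ) * (-(a' θ * m θ + a θ * m' θ)) with hh'
  have hdh : ∀ θ, HasDerivAt h (h' θ) θ := by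
    intro θ
    have h1 : HasDerivAt (fun θ => 2 / (1 - a θ)) (2 * a' θ / (1 - a θ) ^ 2) θ := by
      have := (hasDerivAt_const θ (2:ℝ)).div ((hda θ).const_sub 1) (hpos' θ).ne'
      exact this.congr_deriv (by ring)
    have h2 : HasDerivAt (fun θ => v l - a θ * m θ) (-(a' θ * m θ + a θ * m' θ)) θ :=
      ((hda θ).mul (hdm θ)).const_sub _
    exact h1.mul h2
  have hh'c : Continuous h' := by
    have hne : ∀ θ, 1 - a θ ≠ 0 := fun θ => (hpos' θ).ne'
    have hne2 : ∀ θ, (1 - a θ) ^ 2 ≠ 0 := fun θ => pow_ne_zero _ (hne θ)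
    simp only [hh']
    fun_prop (disch := assumption)
  have hmul1 : ∀ p q : ℝ, |p| ≤ ν → |q| ≤ 1 → |p * q| ≤ 1 := by
    intro p q hp hq
    rw [abs_mul]
    nlinarith [abs_nonneg p, abs_nonneg q]
  have hN : ∀ θ, |v l - a θ * m θ| ≤ 2 := by
    intro θ
    have := abs_sub (v l) (a θ * m θ)
    linarith [hmul1 _ _ (hab θ) (hmb θ)]
  have hN' : ∀ θ, |-(a' θ * m θ + a θ * m' θ)| ≤ 2 := by
    intro θ
    rw [abs_neg]
    have := abs_add_le (a' θ * m θ) (a θ * m' θ)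
    linarith [hmul1 _ _ (ha'b θ) (hmb θ), hmul1 _ _ (hab θ) (hm'b θ)]
  have hD : ∀ θ, |2 / (1 - a θ)| ≤ 2 / (1 - ν) := by
    intro θ
    rw [abs_of_nonneg (div_nonneg zero_le_two (hpos' θ).le)]
    exact div_le_div_of_nonneg_left zero_le_two hν' (hpos θ)
  have hD' : ∀ θ, |2 * a' θ / (1 - a θ) ^ 2| ≤ 2 / (1 - ν) ^ 2 := by
    intro θ
    rw [abs_div, abs_mul, abs_of_nonneg (sq_nonneg (1 - a θ)), abs_two]
    apply div_le_div₀ zero_le_two _ (by positivity) (pow_le_pow_left₀ hν'.le (hpos θ) 2)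
    linarith [ha'b θ]
  have hhb : ∀ θ, |h θ| ≤ 4 / (1 - ν) := by
    intro θ
    simp only [hh]
    rw [abs_mul]
    calc _ ≤ 2 / (1 - ν) * 2 := mul_le_mul (hD θ) (hN θ) (abs_nonneg _) (by positivity)
      _ = _ := by ring
  have hh'b : ∀ θ, |h' θ| ≤ 4 / (1 - ν) ^ 2 + 4 / (1 - ν) := by
    intro θ
    simp only [hh']
    refine (abs_add_le _ _).trans ?_
    rw [abs_mul, abs_mul]
    calc _ ≤ 2 / (1 - ν) ^ 2 * 2 + 2 / (1 - ν) * 2 :=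
          add_le_add (mul_le_mul (hD' θ) (hN θ) (abs_nonneg _) (by positivity))
            (mul_le_mul (hD θ) (hN' θ) (abs_nonneg _) (by positivity))
      _ = _ := by ring
  set g : ℝ → ℝ := fun θ => -(sin (R * cos θ - A) / R) with hg
  have hdg : ∀ θ, HasDerivAt g (sin θ * cos (R * cos θ - A)) θ := by
    intro θ
    have h1 : HasDerivAt (fun θ => R * cos θ - A) (R * -sin θ) θ :=
      ((hasDerivAt_cos θ).const_mul R).sub_const A
    have := (h1.sin.div_const R).neg
    exact this.congr_deriv (by field_simp)
  have hgb : ∀ θ, |g θ| ≤ 1 / R := by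
    intro θ
    simp only [hg]
    rw [abs_neg, abs_div, abs_of_pos hR]
    exact div_le_div_of_nonneg_right (abs_sin_le_one _) hR.le
  have hgc : Continuous g := continuous_iff_continuousAt.2 fun θ => (hdg θ).continuousAt
  have hibp := intervalIntegral.integral_mul_deriv_eq_deriv_mul (a := 0) (b := π)
    (u := h) (u' := h') (v := g) (v' := fun θ => sin θ * cos (R * cos θ - A))
    (fun θ _ => hdh θ) (fun θ _ => hdg θ) (hh'c.intervalIntegrable _ _)
    (Continuous.intervalIntegrable (by fun_prop) _ _)
  have hb1 : ∀ θ, |h θ * g θ| ≤ 4 / (1 - ν) * (1 / R) := fun θ => by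
    rw [abs_mul]
    exact mul_le_mul (hhb θ) (hgb θ) (abs_nonneg _) (by positivity)
  have hb2 : |∫ θ in (0:ℝ)..π, h' θ * g θ| ≤
      ((4 / (1 - ν) ^ 2 + 4 / (1 - ν)) * (1 / R)) * |π - 0| := by
    rw [← Real.norm_eq_abs]
    refine intervalIntegral.norm_integral_le_of_norm_le_const fun θ _ => ?_
    rw [norm_mul]
    exact mul_le_mul (hh'b θ) (hgb θ) (abs_nonneg _) (by positivity)
  rw [sub_zero, abs_of_pos pi_pos] at hb2
  rw [hibp]
  calc _ ≤ |h π * g π| + |h 0 * g 0| + |∫ θ in (0:ℝ)..π, h' θ * g θ| :=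
        (abs_sub _ _).trans (add_le_add (abs_sub _ _) le_rfl)
    _ ≤ 4 / (1 - ν) * (1 / R) + 4 / (1 - ν) * (1 / R) +
        ((4 / (1 - ν) ^ 2 + 4 / (1 - ν)) * (1 / R)) * π :=
        add_le_add (add_le_add (hb1 _) (hb1 _)) hb2
    _ = _ := by ring

/-- Exterior estimate from the proof of Lemma A.2: decay like `(1+|log σ|)/|x|`. -/
theorem statement3 (ν κ : ℝ) (hν0 : 0 < ν) (hν1 : ν < 1) (hκ : 0 < κ) :
    ∃ C : ℝ, ∀ v : E3, ‖v‖ ≤ ν → ∀ σ : ℝ, 0 < σ → σ < κ →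
      ∀ s : ℝ, 0 ≤ s → ∀ x : E3, x ≠ 0 → ∀ l : Fin 3,
      |∫ k in annulus σ κ, (Sig v k) l * Real.cos (⟪k, x⟫ - ‖k‖ * s)| ≤
        C * (1 + |Real.log σ|) / ‖x‖ := by
  set M : ℝ := 8 / (1 - ν) + Real.pi * (4 / (1 - ν) ^ 2 + 4 / (1 - ν)) with hM
  have hν' : 0 < 1 - ν := by linarith
  have hM0 : 0 ≤ M := by have := Real.pi_pos; positivity
  refine ⟨2 * Real.pi * M * (1 + |Real.log κ|), ?_⟩
  intro v hv σ hσ hσκ s _ x hx l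
  have hxn : 0 < ‖x‖ := norm_pos_iff.2 hx
  have hrhs : 0 ≤ 2 * Real.pi * M * (1 + |Real.log κ|) * (1 + |Real.log σ|) / ‖x‖ := by
    have := Real.pi_pos
    positivity
  have hmeas : MeasurableSet (annulus σ κ) := by
    have h1 : annulus σ κ = (fun k : E3 => ‖k‖) ⁻¹' Set.Icc σ κ := rfl
    rw [h1]
    exact measurableSet_Icc.preimage measurable_norm
  rw [← integral_indicator hmeas]
  set F : E3 → ℝ := (annulus σ κ).indicator
    (fun k => (Sig v k) l * Real.cos (⟪k, x⟫ - ‖k‖ * s)) with hF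
  by_cases hFi : Integrable F
  swap
  · rw [integral_undef hFi, abs_zero]
    exact hrhs
  obtain ⟨b, hb⟩ : ∃ b : OrthonormalBasis (Fin 3) ℝ E3, b 0 = ‖x‖⁻¹ • x := by
    have ho : Orthonormal ℝ (({0} : Set (Fin 3)).domRestrict (fun _ : Fin 3 => ‖x‖⁻¹ • x)) := by
      refine ⟨fun i => ?_, fun i j hij => absurd (Subsingleton.elim i j) hij⟩
      change ‖‖x‖⁻¹ • x‖ = 1
      rw [norm_smul, norm_inv, norm_norm, inv_mul_cancel₀ hxn.ne']
    obtain ⟨b, hb⟩ := ho.exists_orthonormalBasis_extension_of_card_eq (by simp)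
    exact ⟨b, hb 0 rfl⟩
  have hxb : x = ‖x‖ • b 0 := by
    rw [hb, smul_smul, mul_inv_cancel₀ hxn.ne', one_smul]
  have hbn : ∀ i, ‖b i‖ = 1 := fun i => b.norm_eq_one i
  have hbo : ∀ i j, i ≠ j → ⟪b i, b j⟫ = 0 := fun i j h => b.orthonormal.2 h
  obtain ⟨hint, heq⟩ := spherical_integral b F hFi
  rw [heq, integral_prod _ hint]
  -- the bounding function
  set B : ℝ → ℝ := (Set.Icc σ κ).indicator (fun r => M / (r * ‖x‖)) with hB
  have hBi : Integrable B (volume.restrict (Set.Ioi (0:ℝ))) := by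
    apply Integrable.restrict
    rw [hB, integrable_indicator_iff measurableSet_Icc]
    apply ContinuousOn.integrableOn_Icc
    intro r hr
    have : r ≠ 0 := (lt_of_lt_of_le hσ hr.1).ne'
    apply ContinuousAt.continuousWithinAt
    apply ContinuousAt.div (by fun_prop) (by fun_prop)
    exact mul_ne_zero this hxn.ne'
  have hBval : ∫ r in Set.Ioi (0:ℝ), B r = M / ‖x‖ * Real.log (κ / σ) := by
    rw [hB, setIntegral_indicator measurableSet_Icc]
    have h1 : Set.Ioi (0:ℝ) ∩ Set.Icc σ κ = Set.Icc σ κ :=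
      Set.inter_eq_right.2 fun r hr => lt_of_lt_of_le hσ hr.1
    rw [h1, integral_Icc_eq_integral_Ioc, ← intervalIntegral.integral_of_le hσκ.le,
      ← integral_one_div_of_pos hσ hκ, ← intervalIntegral.integral_const_mul]
    congr 1 with r
    simp only [div_eq_mul_inv, mul_inv]
    ring
  have hkey : ‖∫ q : ℝ × ℝ, (∫ θ in Set.Ioo 0 Real.pi, (q.2 ^ 2 * Real.sin θ) *
        F (q.2 • (Real.cos θ • b 0 + Real.sin θ •
          (Real.cos q.1 • b 1 + Real.sin q.1 • b 2))))
      ∂((volume.restrict (Set.Ioo (-Real.pi) Real.pi)).prod (volume.restrict (Set.Ioi (0:ℝ))))‖ ≤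
      ∫ q : ℝ × ℝ, (1:ℝ) * B q.2
      ∂((volume.restrict (Set.Ioo (-Real.pi) Real.pi)).prod (volume.restrict (Set.Ioi (0:ℝ)))) := by
    apply norm_integral_le_of_norm_le
    · exact (integrable_const (1:ℝ)).mul_prod hBi
    have hpos := Measure.quasiMeasurePreserving_snd (μ := (volume : Measure ℝ).restrict
      (Set.Ioo (-Real.pi) Real.pi)) (ν := (volume : Measure ℝ).restrict (Set.Ioi (0:ℝ))) |>.ae
      (ae_restrict_mem measurableSet_Ioi)
    filter_upwards [hpos] with q hq
    obtain ⟨φ, r⟩ := q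
    have hr : 0 < r := hq
    dsimp only
    rw [one_mul]
    set w : E3 := Real.cos φ • b 1 + Real.sin φ • b 2 with hw
    have hwn : ‖w‖ = 1 := by
      have : ‖w‖ ^ 2 = 1 := by
        rw [hw, norm_add_sq_real, inner_smul_left, inner_smul_right, hbo 1 2 (by decide),
          norm_smul, norm_smul, hbn, hbn]
        simp
      nlinarith [norm_nonneg w]
    have hew : ⟪b 0, w⟫ = 0 := by
      rw [hw, inner_add_right, inner_smul_right, inner_smul_right, hbo 0 1 (by decide),
        hbo 0 2 (by decide)]
      simp
    have hnn : ∀ θ, ‖Real.cos θ • b 0 + Real.sin θ • w‖ = 1 := by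
      intro θ
      have : ‖Real.cos θ • b 0 + Real.sin θ • w‖ ^ 2 = 1 := by
        rw [norm_add_sq_real, inner_smul_left, inner_smul_right, hew,
          norm_smul, norm_smul, hbn, hwn]
        simp
      nlinarith [norm_nonneg (Real.cos θ • b 0 + Real.sin θ • w)]
    have hrn : ∀ θ, ‖r • (Real.cos θ • b 0 + Real.sin θ • w)‖ = r := by
      intro θ
      rw [norm_smul, hnn, mul_one, Real.norm_eq_abs, abs_of_pos hr]
    by_cases hrI : r ∈ Set.Icc σ κ
    · have hin : ∀ θ, (r ^ 2 * Real.sin θ) * F (r • (Real.cos θ • b 0 + Real.sin θ • w)) =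
          (2 / (1 - ⟪Real.cos θ • b 0 + Real.sin θ • w, v⟫) *
        (v l - ⟪Real.cos θ • b 0 + Real.sin θ • w, v⟫ *
          (Real.cos θ • b 0 + Real.sin θ • w) l)) *
        (Real.sin θ * Real.cos ((r * ‖x‖) * Real.cos θ - r * s)) := by
        intro θ
        have hmem : r • (Real.cos θ • b 0 + Real.sin θ • w) ∈ annulus σ κ := by
          simp only [annulus, Set.mem_ofPred_eq, hrn]
          exact hrI
        rw [hF, Set.indicator_of_mem hmem]
        have hphase : ⟪r • (Real.cos θ • b 0 + Real.sin θ • w), x⟫ =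
            (r * ‖x‖) * Real.cos θ := by
          rw [hxb, real_inner_smul_left, real_inner_smul_right, inner_add_left,
            real_inner_smul_left, real_inner_smul_left, real_inner_comm (b 0) w, hew,
            real_inner_self_eq_norm_sq, hbn, ← hxb]
          ring
        rw [hphase, Sig, hrn]
        set n := Real.cos θ • b 0 + Real.sin θ • w with hn
        have hinn : ⟪r • n, v⟫ = r * ⟪n, v⟫ := real_inner_smul_left _ _ _
        have hd : 0 < 1 - ⟪n, v⟫ := by
          have := real_inner_le_norm n v
          rw [hnn θ] at this
          linarith
        have h1 : r * ⟪n, v⟫ / r = ⟪n, v⟫ := by field_simp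
        rw [hinn, h1]
        simp only [PiLp.smul_apply, PiLp.sub_apply, smul_eq_mul]
        field_simp
      simp_rw [hin]
      rw [← integral_Ioc_eq_integral_Ioo, ← intervalIntegral.integral_of_le Real.pi_pos.le,
        hB, Set.indicator_of_mem hrI, Real.norm_eq_abs]
      exact theta_bound ν hν1 v (b 0) w hv (hbn 0) hwn hew l (r * ‖x‖) (r * s) (by positivity)
    · have hz : ∀ θ, F (r • (Real.cos θ • b 0 + Real.sin θ • w)) = 0 := by
        intro θ
        rw [hF, Set.indicator_of_notMem]
        simp only [annulus, Set.mem_ofPred_eq, hrn]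
        exact hrI
      simp_rw [hz]
      simp [hB, hrI]
  rw [← Real.norm_eq_abs]
  refine hkey.trans ?_
  rw [integral_prod_mul (fun _ => (1:ℝ)) B, hBval]
  have hvol : ∫ _ in Set.Ioo (-Real.pi) Real.pi, (1:ℝ) = 2 * Real.pi := by
    have := Real.pi_pos
    simp [Measure.real, Real.volume_Ioo]
    rw [ENNReal.toReal_ofReal (by linarith)]
    ring
  rw [hvol, Real.log_div hκ.ne' hσ.ne']
  have hlog : Real.log κ - Real.log σ ≤ (1 + |Real.log κ|) * (1 + |Real.log σ|) := by
    nlinarith [le_abs_self (Real.log κ), neg_abs_le (Real.log σ),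
      mul_nonneg (abs_nonneg (Real.log κ)) (abs_nonneg (Real.log σ))]
  calc 2 * Real.pi * (M / ‖x‖ * (Real.log κ - Real.log σ))
      ≤ 2 * Real.pi * (M / ‖x‖ * ((1 + |Real.log κ|) * (1 + |Real.log σ|))) := by
        have := Real.pi_pos
        gcongr
    _ = _ := by ring
end
end

section
/- Let θ ∈ (0,1), α > 0 and 0 < ν < 1. There exists a constant C = C(ν, θ, α) such that for every σ ∈ (0,1) and all vectors u, v, v' ∈ ℝ³ with |u| ≤ ν, |v| ≤ ν, |v'| ≤ ν, one has |γ_σ(v, u, σ^{−1/θ}) − γ_σ(v', u, σ^{−1/θ})| ≤ C |v − v'|, uniformly in σ. -/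
open MeasureTheory
open scoped RealInnerProductSpace

noncomputable section

/-- The infrared phase
`γ_σ(v,u,t) = −α ∫₁^{min(t, σ^{−1/θ})} u · ( ∫_{A(σ, τ^{−θ})} Σ_v(k) cos(k·u τ − |k| τ) dk ) dτ`.
(The inner integral is automatically `0` when `τ^{−θ} < σ`, since then the annulus is empty.) -/
def gammaIR (α θ : ℝ) (v u : E3) (σ t : ℝ) : ℝ :=
  -α * ∫ τ in (1:ℝ)..(min t (σ ^ (-(1/θ)))),
    ⟪u, ∫ k in annulus σ (τ ^ (-θ)),
        Real.cos (⟪k, u⟫ * τ - ‖k‖ * τ) • Sig v k⟫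


open Set in
theorem polar_E3 (f : E3 → ℝ) (hf : Integrable f) :
    ∫ k, f k = ∫ ω : Metric.sphere (0 : E3) 1, (∫ r in Set.Ioi (0:ℝ), r ^ 2 * f (r • (ω : E3)))
      ∂(volume : Measure E3).toSphere := by
  have hd : Module.finrank ℝ E3 - 1 = 2 := by simp
  have hmp := (volume : Measure E3).measurePreserving_homeomorphUnitSphereProd
  rw [hd] at hmp
  let g : Metric.sphere (0 : E3) 1 × Set.Ioi (0:ℝ) → ℝ := fun p => f ((p.2 : ℝ) • (p.1 : E3))
  have hg : ∀ x : ({0}ᶜ : Set E3), g (homeomorphUnitSphereProd E3 x) = f x := by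
    intro x
    have := congrArg Subtype.val ((homeomorphUnitSphereProd E3).symm_apply_apply x)
    simp only [g]
    congr 1
  have hgi : Integrable g ((volume : Measure E3).toSphere.prod (Measure.volumeIoiPow 2)) := by
    rw [← hmp.integrable_comp_emb (Homeomorph.measurableEmbedding _)]
    have : g ∘ (homeomorphUnitSphereProd E3) = f ∘ Subtype.val := funext hg
    rw [this, ← integrableOn_iff_comap_subtypeVal (measurableSet_singleton _).compl]
    exact hf.integrableOn
  calc
    ∫ k, f k = ∫ x : ({(0)}ᶜ : Set E3), f x ∂((volume : Measure E3).comap (↑)) := by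
      rw [integral_subtype_comap (measurableSet_singleton _).compl f,
        restrict_compl_singleton]
    _ = ∫ x, g x ∂(volume : Measure E3).toSphere.prod (.volumeIoiPow 2) := by
      rw [← hmp.integral_comp (Homeomorph.measurableEmbedding _)]
      exact integral_congr_ae (Filter.Eventually.of_forall fun x => (hg x).symm)
    _ = _ := by
      rw [integral_prod _ hgi]
      congr 1
      ext ω
      simp only [Measure.volumeIoiPow, ENNReal.ofReal, g]
      rw [integral_withDensity_eq_integral_smul,
        integral_subtype_comap measurableSet_Ioi
          fun a ↦ Real.toNNReal (a ^ 2) • f (a • (ω : E3)),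
        setIntegral_congr_fun measurableSet_Ioi fun x hx ↦ ?_]
      · rw [NNReal.smul_def, Real.coe_toNNReal _ (pow_nonneg (le_of_lt hx) _)]
        rfl
      · exact (measurable_subtype_coe.pow_const _).real_toNNReal

theorem osc_bound (a b c p : ℝ) (ha : 0 < a) (hab : a ≤ b) (hc : 0 < c) (hp : 0 < p) :
    |∫ τ in a..b, Real.sin (c * τ ^ p) / τ| ≤ 3 / (c * p * a ^ p) := by
  have hpos : ∀ τ ∈ Set.uIcc a b, 0 < τ := by
    intro τ h; rw [Set.uIcc_of_le hab] at h; exact ha.trans_le h.1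
  have hc1 : ContinuousOn (fun τ : ℝ => Real.sin (c * τ ^ p) / τ) (Set.uIcc a b) := by
    intro τ h
    have := hpos τ h
    refine ContinuousAt.continuousWithinAt ?_
    refine ContinuousAt.div ?_ continuousAt_id this.ne'
    exact Real.continuous_sin.continuousAt.comp
      (continuousAt_const.mul (Real.continuousAt_rpow_const _ _ (Or.inl this.ne')))
  have hc2 : ContinuousOn (fun τ : ℝ => Real.cos (c * τ ^ p) * (τ ^ (-p - 1) / c))
      (Set.uIcc a b) := by
    intro τ h
    have := hpos τ h
    refine ContinuousAt.continuousWithinAt ?_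
    refine ContinuousAt.mul ?_ ((Real.continuousAt_rpow_const _ _ (Or.inl this.ne')).div_const _)
    exact Real.continuous_cos.continuousAt.comp
      (continuousAt_const.mul (Real.continuousAt_rpow_const _ _ (Or.inl this.ne')))
  have hc3 : ContinuousOn (fun τ : ℝ => τ ^ (-p - 1) / c) (Set.uIcc a b) := by
    intro τ h
    have := hpos τ h
    exact ((Real.continuousAt_rpow_const _ _ (Or.inl this.ne')).div_const _).continuousWithinAt
  let F : ℝ → ℝ := fun τ => - Real.cos (c * τ ^ p) * (τ ^ (-p) / (c * p))
  have hF : ∀ τ ∈ Set.uIcc a b, HasDerivAt F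
      (Real.sin (c * τ ^ p) / τ + Real.cos (c * τ ^ p) * (τ ^ (-p - 1) / c)) τ := by
    intro τ h
    have hτ := hpos τ h
    have h1 := ((Real.hasDerivAt_rpow_const (p := p) (Or.inl hτ.ne')).const_mul c).cos.neg
    have h2 := (Real.hasDerivAt_rpow_const (p := -p) (Or.inl hτ.ne')).div_const (c * p)
    have h3 : HasDerivAt F _ τ := h1.mul h2
    refine h3.congr_deriv ?_
    simp only [Pi.neg_apply]
    symm
    have e1 : τ ^ (p - 1) * τ ^ (-p) = τ⁻¹ := by
      rw [← Real.rpow_add hτ, ← Real.rpow_neg_one]; congr 1; ring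
    have : -(-Real.sin (c * τ ^ p) * (c * (p * τ ^ (p - 1)))) * (τ ^ (-p) / (c * p))
        = Real.sin (c * τ ^ p) * (τ ^ (p - 1) * τ ^ (-p)) := by field_simp
    rw [this, e1]
    field_simp
  have hFTC := intervalIntegral.integral_eq_sub_of_hasDerivAt hF
    (hc1.intervalIntegrable.add hc2.intervalIntegrable)
  rw [intervalIntegral.integral_add hc1.intervalIntegrable hc2.intervalIntegrable] at hFTC
  have hFb : ∀ τ, a ≤ τ → |F τ| ≤ a ^ (-p) / (c * p) := by
    intro τ h
    have hτ : 0 < τ := ha.trans_le h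
    simp only [F, abs_mul, abs_neg]
    rw [abs_of_nonneg (by positivity : 0 ≤ τ ^ (-p) / (c * p))]
    calc _ ≤ 1 * (τ ^ (-p) / (c * p)) := by
          gcongr; exact Real.abs_cos_le_one _
      _ ≤ _ := by
          rw [one_mul]
          refine div_le_div_of_nonneg_right ?_ (by positivity)
          exact Real.rpow_le_rpow_of_nonpos ha h (neg_nonpos.2 hp.le)
  have hI : |∫ τ in a..b, Real.cos (c * τ ^ p) * (τ ^ (-p - 1) / c)| ≤ a ^ (-p) / (c * p) := by
    calc _ ≤ ∫ τ in a..b, τ ^ (-p - 1) / c := by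
          rw [← Real.norm_eq_abs]
          refine intervalIntegral.norm_integral_le_of_norm_le hab ?_ hc3.intervalIntegrable
          refine Filter.Eventually.of_forall fun τ hτ => ?_
          have hτ0 : 0 < τ := ha.trans hτ.1
          rw [norm_mul, Real.norm_eq_abs, Real.norm_eq_abs,
            abs_of_nonneg (by positivity : 0 ≤ τ ^ (-p - 1) / c)]
          exact mul_le_of_le_one_left (by positivity) (Real.abs_cos_le_one _)
      _ = (a ^ (-p) - b ^ (-p)) / (c * p) := by
          rw [intervalIntegral.integral_div, integral_rpow]
          · rw [show -p - 1 + 1 = -p by ring]; field_simp; ring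
          · right
            refine ⟨by linarith, fun h => (hpos 0 h).ne' rfl⟩
      _ ≤ _ := by
          gcongr
          have : 0 < b ^ (-p) := Real.rpow_pos_of_pos (ha.trans_le hab) _
          linarith
  have e : 3 / (c * p * a ^ p) = 3 * (a ^ (-p) / (c * p)) := by
    rw [Real.rpow_neg ha.le]; field_simp
  rw [e]
  have h1 := abs_le.1 (hFb a le_rfl)
  have h2 := abs_le.1 (hFb b hab)
  have h3 := abs_le.1 hI
  rw [abs_le]
  constructor <;> linarith

theorem Sig_smul (v u ω : E3) (hω : ‖ω‖ = 1) (r : ℝ) (hr : 0 < r) :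
    r ^ 2 * ⟪u, Sig v (r • ω)⟫ = ⟪u, Sig v ω⟫ := by
  simp only [Sig, norm_smul, hω, Real.norm_eq_abs, abs_of_pos hr, inner_smul_left, inner_smul_right,
    inner_sub_right, smul_smul]
  simp
  field_simp

theorem c_bounds (ν : ℝ) (u ω : E3) (hu : ‖u‖ ≤ ν) (hω : ‖ω‖ = 1) :
    1 - ν ≤ 1 - ⟪ω, u⟫ ∧ 1 - ⟪ω, u⟫ ≤ 1 + ν := by
  have h0 := abs_real_inner_le_norm ω u
  rw [hω, one_mul] at h0
  have := abs_le.1 (h0.trans hu)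
  constructor <;> linarith

theorem Sig_lip (ν : ℝ) (hν1 : ν < 1) (u v v' ω : E3) (hu : ‖u‖ ≤ ν) (hv : ‖v‖ ≤ ν)
    (hv' : ‖v'‖ ≤ ν) (hω : ‖ω‖ = 1) :
    |⟪u, Sig v ω⟫ - ⟪u, Sig v' ω⟫| ≤ 12 / (1 - ν) ^ 2 * ‖v - v'‖ := by
  obtain ⟨hd1, hd2⟩ := c_bounds ν v ω hv hω
  obtain ⟨hd1', hd2'⟩ := c_bounds ν v' ω hv' hω
  have hS : ∀ w : E3, ⟪u, Sig w ω⟫ = 2 * (⟪u, w⟫ - ⟪ω, w⟫ * ⟪u, ω⟫) / (1 - ⟪ω, w⟫) := by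
    intro w
    simp only [Sig, hω, inner_smul_right, inner_sub_right]
    simp
    ring
  have hN : ∀ w : E3, |⟪u, w⟫ - ⟪ω, w⟫ * ⟪u, ω⟫| ≤ 2 * ‖w‖ := by
    intro w
    have h1 := abs_real_inner_le_norm u w
    have h2 := abs_real_inner_le_norm ω w
    have h3 := abs_real_inner_le_norm u ω
    rw [hω] at h2 h3
    have hw := norm_nonneg w
    calc _ ≤ |⟪u, w⟫| + |⟪ω, w⟫ * ⟪u, ω⟫| := abs_sub _ _
      _ ≤ 1 * ‖w‖ + ‖w‖ * 1 := by
        rw [abs_mul]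
        gcongr
        · exact h1.trans (by gcongr; linarith)
        · linarith
        · linarith
      _ = _ := by ring
  have hdd : |⟪ω, v - v'⟫| ≤ ‖v - v'‖ := by
    simpa [hω] using abs_real_inner_le_norm ω (v - v')
  have hNd := hN (v - v')
  have hN' := hN v'
  have hd : 0 < 1 - ⟪ω, v⟫ := by linarith
  have hd' : 0 < 1 - ⟪ω, v'⟫ := by linarith
  rw [hS, hS]
  set N := ⟪u, v - v'⟫ - ⟪ω, v - v'⟫ * ⟪u, ω⟫ with hNe
  set N' := ⟪u, v'⟫ - ⟪ω, v'⟫ * ⟪u, ω⟫ with hNe'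
  have key : 2 * (⟪u, v⟫ - ⟪ω, v⟫ * ⟪u, ω⟫) / (1 - ⟪ω, v⟫) - 2 * N' / (1 - ⟪ω, v'⟫)
      = (2 * N * (1 - ⟪ω, v'⟫) + 2 * N' * ⟪ω, v - v'⟫) / ((1 - ⟪ω, v⟫) * (1 - ⟪ω, v'⟫)) := by
    rw [div_sub_div _ _ hd.ne' hd'.ne']
    congr 1
    rw [hNe, hNe', inner_sub_right, inner_sub_right]
    ring
  rw [key, abs_div, abs_of_pos (mul_pos hd hd'), div_mul_eq_mul_div]
  have hν : 0 < 1 - ν := by linarith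
  gcongr
  · calc _ ≤ |2 * N * (1 - ⟪ω, v'⟫)| + |2 * N' * ⟪ω, v - v'⟫| := abs_add_le _ _
      _ = 2 * |N| * (1 - ⟪ω, v'⟫) + 2 * |N'| * |⟪ω, v - v'⟫| := by
        simp [abs_mul, abs_of_pos hd']
      _ ≤ 2 * (2 * ‖v - v'‖) * 2 + 2 * (2 * 1) * ‖v - v'‖ := by
        gcongr
        · linarith
        · exact hN'.trans (by linarith)
      _ = _ := by ring
  · rw [sq]; gcongr

theorem annulus_compact (a b : ℝ) : IsCompact (annulus a b) := by
  have : annulus a b ⊆ Metric.closedBall (0 : E3) b := by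
    intro k hk; simpa using hk.2
  refine (isCompact_closedBall (0 : E3) b).of_isClosed_subset ?_ this
  exact (isClosed_le continuous_const continuous_norm).inter
    (isClosed_le continuous_norm continuous_const)

theorem Sig_contOn (ν : ℝ) (hν1 : ν < 1) (v : E3) (hv : ‖v‖ ≤ ν) :
    ContinuousOn (Sig v) {k | k ≠ 0} := by
  intro k hk
  refine ContinuousAt.continuousWithinAt ?_
  have hk' : ‖k‖ ≠ 0 := norm_ne_zero_iff.2 hk
  have hd : 1 - ⟪k, v⟫ / ‖k‖ ≠ 0 := by
    have h0 := (abs_le.1 (abs_real_inner_le_norm k v)).2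
    have hkp : 0 < ‖k‖ := norm_pos_iff.2 hk
    have : ⟪k, v⟫ / ‖k‖ ≤ ν := by
      rw [div_le_iff₀ hkp]; nlinarith
    intro h; linarith
  unfold Sig
  have hden : ‖k‖ ^ 2 * (1 - ⟪k, v⟫ / ‖k‖) ≠ 0 := mul_ne_zero (pow_ne_zero 2 hk') hd
  have h2 : ‖k‖ ^ 2 ≠ 0 := pow_ne_zero 2 hk'
  fun_prop (disch := assumption)

/-- The angular phase after integrating out the radius. -/
def Gang (θ σ : ℝ) (u : E3) (τ : ℝ) (ω : E3) : ℝ :=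
  (Real.sin ((1 - ⟪ω, u⟫) * τ ^ (1 - θ)) - Real.sin ((σ * (1 - ⟪ω, u⟫)) * τ)) / ((1 - ⟪ω, u⟫) * τ)

theorem inner_eq (θ ν σ τ : ℝ) (hν1 : ν < 1) (hσ : 0 < σ)
    (hτ : 0 < τ) (hστ : σ ≤ τ ^ (-θ)) (u v : E3) (hu : ‖u‖ ≤ ν) (hv : ‖v‖ ≤ ν) :
    ⟪u, ∫ k in annulus σ (τ ^ (-θ)), Real.cos (⟪k, u⟫ * τ - ‖k‖ * τ) • Sig v k⟫
    = ∫ ω : Metric.sphere (0 : E3) 1, ⟪u, Sig v ω⟫ * Gang θ σ u τ ω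
      ∂(volume : Measure E3).toSphere := by
  set b := τ ^ (-θ) with hb
  have hms : MeasurableSet (annulus σ b) := (annulus_compact σ b).measurableSet
  have hcont : ContinuousOn (fun k : E3 => Real.cos (⟪k, u⟫ * τ - ‖k‖ * τ) • Sig v k)
      (annulus σ b) := by
    have hcos : Continuous fun k : E3 => Real.cos (⟪k, u⟫ * τ - ‖k‖ * τ) := by fun_prop
    refine ContinuousOn.smul hcos.continuousOn ((Sig_contOn ν hν1 v hv).mono ?_)
    intro k hk
    exact norm_pos_iff.1 (hσ.trans_le hk.1)
  have hint := hcont.integrableOn_compact (μ := volume) (annulus_compact σ b)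
  have hint2 : IntegrableOn (fun k : E3 => ⟪u, Real.cos (⟪k, u⟫ * τ - ‖k‖ * τ) • Sig v k⟫)
      (annulus σ b) := hint.const_inner u
  rw [← integral_inner hint, ← integral_indicator hms, polar_E3 _ (hint2.integrable_indicator hms)]
  congr 1
  ext ω
  have hω : ‖(ω : E3)‖ = 1 := by simp
  have hc := c_bounds ν u ω hu hω
  have hc0 : 0 < 1 - ⟪(ω : E3), u⟫ := by linarith [hc.1]
  have e1 : ∫ r in Set.Ioi (0:ℝ), r ^ 2 * (annulus σ b).indicator
        (fun k : E3 => ⟪u, Real.cos (⟪k, u⟫ * τ - ‖k‖ * τ) • Sig v k⟫) (r • (ω : E3))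
      = ∫ r in Set.Ioi (0:ℝ), (Set.Icc σ b).indicator
        (fun r => ⟪u, Sig v ω⟫ * Real.cos (((1 - ⟪(ω : E3), u⟫) * τ) * r)) r := by
    refine setIntegral_congr_fun measurableSet_Ioi fun r hr => ?_
    have hr : 0 < r := hr
    have hn : ‖r • (ω : E3)‖ = r := by rw [norm_smul, hω, mul_one, Real.norm_eq_abs, abs_of_pos hr]
    by_cases hm : r ∈ Set.Icc σ b
    · have hm' : r • (ω : E3) ∈ annulus σ b := by
        simp only [annulus, Set.mem_ofPred_eq, hn]; exact hm
      simp only [Set.indicator_of_mem hm, Set.indicator_of_mem hm']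
      rw [hn, ← Sig_smul v u ω hω r hr, inner_smul_right, real_inner_smul_left]
      have : Real.cos (r * ⟪(ω : E3), u⟫ * τ - r * τ)
          = Real.cos (((1 - ⟪(ω : E3), u⟫) * τ) * r) := by
        rw [← Real.cos_neg]; congr 1; ring
      rw [this]; ring
    · have hm' : r • (ω : E3) ∉ annulus σ b := by
        simp only [annulus, Set.mem_ofPred_eq, hn]; exact hm
      simp only [Set.indicator_of_notMem hm, Set.indicator_of_notMem hm', mul_zero]
  rw [e1, setIntegral_indicator measurableSet_Icc]
  have e2 : Set.Ioi (0:ℝ) ∩ Set.Icc σ b = Set.Icc σ b :=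
    Set.inter_eq_right.2 fun r hr => hσ.trans_le hr.1
  rw [e2, integral_Icc_eq_integral_Ioc, ← intervalIntegral.integral_of_le hστ,
    intervalIntegral.integral_const_mul]
  congr 1
  have hne : (1 - ⟪(ω : E3), u⟫) * τ ≠ 0 := (mul_pos hc0 hτ).ne'
  rw [intervalIntegral.integral_comp_mul_left (fun x => Real.cos x) hne, integral_cos, Gang]
  have e3 : (1 - ⟪(ω : E3), u⟫) * τ * b = (1 - ⟪(ω : E3), u⟫) * τ ^ (1 - θ) := by
    rw [hb, mul_assoc, sub_eq_add_neg 1 θ, Real.rpow_add hτ, Real.rpow_one]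
  rw [e3, smul_eq_mul, inv_mul_eq_div]
  congr 3
  ring

theorem Gang_int_bound (θ ν σ : ℝ) (hθ0 : 0 < θ) (hθ1 : θ < 1) (hν1 : ν < 1)
    (hσ : 0 < σ) (hσ1 : σ < 1) (u ω : E3) (hu : ‖u‖ ≤ ν) (hω : ‖ω‖ = 1) :
    |∫ τ in (1:ℝ)..(σ ^ (-(1/θ))), Gang θ σ u τ ω| ≤
      (3 / ((1 - ν) * (1 - θ)) + 2 + 3 / (1 - ν)) / (1 - ν) := by
  obtain ⟨hc1, hc2⟩ := c_bounds ν u ω hu hω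
  have hν : 0 < 1 - ν := by linarith
  have hp : 0 < 1 - θ := by linarith
  set c := 1 - ⟪ω, u⟫ with hc
  have hc0 : 0 < c := by linarith
  set T := σ ^ (-(1/θ)) with hT
  have hσi : σ⁻¹ ≤ T := by
    rw [hT, ← Real.rpow_neg_one]
    apply Real.rpow_le_rpow_of_exponent_ge hσ hσ1.le
    rw [neg_le_neg_iff, le_div_iff₀ hθ0]; linarith
  have h1σ : 1 ≤ σ⁻¹ := (one_le_inv₀ hσ).2 hσ1.le
  have hsin2 : ∀ a b : ℝ, 1 ≤ a → a ≤ b →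
      IntervalIntegrable (fun τ => Real.sin ((σ * c) * τ) / τ) volume a b := by
    intro a b ha hab
    apply ContinuousOn.intervalIntegrable
    rw [Set.uIcc_of_le hab]
    refine ContinuousOn.div (by fun_prop) continuousOn_id ?_
    intro x hx; exact (lt_of_lt_of_le (by linarith) hx.1).ne'
  have hsin1 : IntervalIntegrable (fun τ => Real.sin (c * τ ^ (1 - θ)) / τ) volume 1 T := by
    apply ContinuousOn.intervalIntegrable
    rw [Set.uIcc_of_le (h1σ.trans hσi)]
    refine ContinuousOn.div ?_ continuousOn_id ?_
    · refine Real.continuous_sin.comp_continuousOn (continuousOn_const.mul ?_)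
      exact continuousOn_id.rpow_const fun x hx => Or.inr hp.le
    · intro x hx; exact (lt_of_lt_of_le (by linarith) hx.1).ne'
  have e : ∀ τ, Gang θ σ u τ ω
      = (Real.sin (c * τ ^ (1 - θ)) / τ - Real.sin ((σ * c) * τ) / τ) / c := by
    intro τ
    rw [Gang, ← hc, ← sub_div, div_div, mul_comm τ c]
  simp_rw [e]
  rw [intervalIntegral.integral_div, intervalIntegral.integral_sub hsin1
    (hsin2 1 T le_rfl (h1σ.trans hσi)), abs_div, abs_of_pos hc0,
    ← intervalIntegral.integral_add_adjacent_intervals (hsin2 1 σ⁻¹ le_rfl h1σ)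
      (hsin2 σ⁻¹ T h1σ hσi)]
  have b1 := osc_bound 1 T c (1 - θ) one_pos (h1σ.trans hσi) hc0 hp
  have b3 := osc_bound σ⁻¹ T (σ * c) 1 (by positivity) hσi (by positivity) one_pos
  simp only [Real.rpow_one, Real.one_rpow, mul_one] at b1 b3
  have b2 : |∫ τ in (1:ℝ)..σ⁻¹, Real.sin ((σ * c) * τ) / τ| ≤ 2 := by
    have := intervalIntegral.norm_integral_le_of_norm_le_const (a := 1) (b := σ⁻¹)
      (f := fun τ => Real.sin ((σ * c) * τ) / τ) (C := σ * c) ?_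
    · rw [Real.norm_eq_abs] at this
      refine this.trans ?_
      rw [abs_of_nonneg (by linarith)]
      have : σ * c * (σ⁻¹ - 1) = c - σ * c := by field_simp
      rw [this]
      have : 0 < σ * c := by positivity
      linarith
    · intro τ hτ
      rw [Set.uIoc_of_le h1σ] at hτ
      have hτ0 : 0 < τ := by linarith [hτ.1]
      rw [Real.norm_eq_abs, abs_div, abs_of_pos hτ0, div_le_iff₀ hτ0]
      refine Real.abs_sin_le_abs.trans ?_
      rw [abs_of_pos (by positivity)]
  have b1' : 3 / (c * (1 - θ)) ≤ 3 / ((1 - ν) * (1 - θ)) := by gcongr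
  have b3' : 3 / (σ * c * σ⁻¹) ≤ 3 / (1 - ν) := by
    have : σ * c * σ⁻¹ = c := by field_simp
    rw [this]; gcongr
  have h1 := abs_le.1 b1
  have h2 := abs_le.1 b2
  have h3 := abs_le.1 b3
  gcongr
  rw [abs_le]
  constructor <;> linarith

theorem swap_lemma (θ ν σ T : ℝ) (hθ1 : θ < 1) (hν1 : ν < 1) (hT : 1 ≤ T)
    (u v : E3) (hu : ‖u‖ ≤ ν) (hv : ‖v‖ ≤ ν) :
    Integrable (fun ω : Metric.sphere (0 : E3) 1 =>
        ⟪u, Sig v ω⟫ * ∫ τ in (1:ℝ)..T, Gang θ σ u τ ω) (volume : Measure E3).toSphere ∧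
    ∫ τ in (1:ℝ)..T, (∫ ω : Metric.sphere (0 : E3) 1, ⟪u, Sig v ω⟫ * Gang θ σ u τ ω
      ∂(volume : Measure E3).toSphere) =
    ∫ ω : Metric.sphere (0 : E3) 1, (⟪u, Sig v ω⟫ * ∫ τ in (1:ℝ)..T, Gang θ σ u τ ω)
      ∂(volume : Measure E3).toSphere := by
  have hcont : ContinuousOn (fun p : ℝ × Metric.sphere (0 : E3) 1 =>
      ⟪u, Sig v p.2⟫ * Gang θ σ u p.1 p.2) (Set.Icc 1 T ×ˢ Set.univ) := by
    refine ContinuousOn.mul ?_ ?_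
    · refine ContinuousOn.inner continuousOn_const ?_
      refine (Sig_contOn ν hν1 v hv).comp (t := {k | k ≠ 0}) (f := fun p : ℝ × Metric.sphere (0 : E3) 1 => (p.2 : E3)) (by fun_prop) ?_
      intro p _
      have : ‖(p.2 : E3)‖ = 1 := by simp
      exact norm_pos_iff.1 (by rw [this]; exact one_pos)
    · unfold Gang
      have hr : ContinuousOn (fun p : ℝ × Metric.sphere (0 : E3) 1 => p.1 ^ (1 - θ))
          (Set.Icc 1 T ×ˢ Set.univ) :=
        continuousOn_fst.rpow_const fun x hx => Or.inr (by linarith)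
      refine ContinuousOn.div ?_ (by fun_prop) ?_
      · refine ContinuousOn.sub ?_ (by fun_prop)
        exact Real.continuous_sin.comp_continuousOn (ContinuousOn.mul (by fun_prop) hr)
      · intro p hp
        have h1 : 1 ≤ p.1 := hp.1.1
        have := (c_bounds ν u p.2 hu (by simp)).1
        exact mul_ne_zero (by linarith) (by linarith)
  have hint0 := hcont.integrableOn_compact (μ := volume.prod (volume : Measure E3).toSphere)
    (isCompact_Icc.prod isCompact_univ)
  have hint : Integrable (Function.uncurry fun (τ : ℝ) (ω : Metric.sphere (0 : E3) 1) =>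
      ⟪u, Sig v ω⟫ * Gang θ σ u τ ω)
      ((volume.restrict (Set.Ioc 1 T)).prod (volume : Measure E3).toSphere) := by
    have := hint0.mono_set (Set.prod_mono Set.Ioc_subset_Icc_self (subset_refl Set.univ))
    rw [IntegrableOn, ← Measure.prod_restrict, Measure.restrict_univ] at this
    exact this
  simp_rw [intervalIntegral.integral_of_le hT]
  simp_rw [← integral_const_mul]
  exact ⟨hint.integral_prod_right, integral_integral_swap hint⟩

/-- Lemma A.1(i): Lipschitz dependence of the infrared phase on the coherent-cloud
velocity, uniformly in the infrared cutoff. -/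
theorem statement5 (θ α ν : ℝ) (hθ0 : 0 < θ) (hθ1 : θ < 1) (hα : 0 < α)
    (hν0 : 0 < ν) (hν1 : ν < 1) :
    ∃ C : ℝ, ∀ σ : ℝ, 0 < σ → σ < 1 → ∀ u v v' : E3, ‖u‖ ≤ ν → ‖v‖ ≤ ν → ‖v'‖ ≤ ν →
      |gammaIR α θ v u σ (σ ^ (-(1/θ))) - gammaIR α θ v' u σ (σ ^ (-(1/θ)))| ≤
        C * ‖v - v'‖ := by
  set K := (3 / ((1 - ν) * (1 - θ)) + 2 + 3 / (1 - ν)) / (1 - ν) with hK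
  have hν : 0 < 1 - ν := by linarith
  have hp : 0 < 1 - θ := by linarith
  have hK0 : 0 < K := by positivity
  set M := (volume : Measure E3).toSphere.real Set.univ with hM
  refine ⟨α * (12 / (1 - ν) ^ 2 * K * M), ?_⟩
  intro σ hσ hσ1 u v v' hu hv hv'
  have hT1 : 1 ≤ σ ^ (-(1/θ)) := by
    apply Real.one_le_rpow_of_pos_of_le_one_of_nonpos hσ hσ1.le
    have : 0 < 1 / θ := by positivity
    linarith
  have hg : ∀ w : E3, ‖w‖ ≤ ν → gammaIR α θ w u σ (σ ^ (-(1/θ))) =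
      -α * ∫ ω : Metric.sphere (0 : E3) 1,
        (⟪u, Sig w ω⟫ * ∫ τ in (1:ℝ)..(σ ^ (-(1/θ))), Gang θ σ u τ ω)
        ∂(volume : Measure E3).toSphere := by
    intro w hw
    rw [gammaIR, min_self, ← (swap_lemma θ ν σ _ hθ1 hν1 hT1 u w hu hw).2]
    congr 1
    refine intervalIntegral.integral_congr fun τ hτ => ?_
    rw [Set.uIcc_of_le hT1] at hτ
    have hτ0 : 0 < τ := by linarith [hτ.1]
    refine inner_eq θ ν σ τ hν1 hσ hτ0 ?_ u w hu hw
    calc σ = (σ ^ (-(1/θ))) ^ (-θ) := by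
          rw [← Real.rpow_mul hσ.le]
          have : -(1/θ) * -θ = 1 := by field_simp
          rw [this, Real.rpow_one]
      _ ≤ _ := Real.rpow_le_rpow_of_nonpos hτ0 hτ.2 (neg_nonpos.2 hθ0.le)
  rw [hg v hv, hg v' hv', ← mul_sub, ← integral_sub (swap_lemma θ ν σ _ hθ1 hν1 hT1 u v hu hv).1
    (swap_lemma θ ν σ _ hθ1 hν1 hT1 u v' hu hv').1, abs_mul, abs_neg, abs_of_pos hα, mul_assoc]
  gcongr
  have := norm_integral_le_of_norm_le_const (μ := (volume : Measure E3).toSphere)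
    (f := fun ω : Metric.sphere (0 : E3) 1 =>
      (⟪u, Sig v ω⟫ * ∫ τ in (1:ℝ)..(σ ^ (-(1/θ))), Gang θ σ u τ ω) -
      (⟪u, Sig v' ω⟫ * ∫ τ in (1:ℝ)..(σ ^ (-(1/θ))), Gang θ σ u τ ω))
    (C := (12 / (1 - ν) ^ 2 * ‖v - v'‖) * K) (Filter.Eventually.of_forall fun ω => ?_)
  · rw [Real.norm_eq_abs] at this
    refine this.trans (le_of_eq ?_)
    rw [← hM]; ring
  · have hω : ‖(ω : E3)‖ = 1 := by simp
    rw [← sub_mul, norm_mul, Real.norm_eq_abs, Real.norm_eq_abs]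
    gcongr
    · exact Sig_lip ν hν1 u v v' ω hu hv hv' hω
    · exact Gang_int_bound θ ν σ hθ0 hθ1 hν1 hσ hσ1 u ω hu hω
end
end

section
/- Let θ ∈ (0,1), α > 0 and 0 < ν < 1. There exists a constant C = C(ν, θ, α) such that for every σ ∈ (0,1), every s with 1 ≤ s ≤ σ^{−1/θ}, and all vectors v, u, u' ∈ ℝ³ with |v| ≤ ν, |u| ≤ ν, |u'| ≤ ν, one has |γ_σ(v, u, s) − γ_σ(v, u', s)| ≤ C |u − u'| s^{1−θ}. -/
open MeasureTheory
open scoped RealInnerProductSpace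

noncomputable section

open Set Metric in
lemma polar_aux (f : E3 → ℝ) (hf : Integrable f) :
    ∫ k, f k = ∫ w : sphere (0 : E3) 1, (∫ r in Ioi (0:ℝ), r ^ 2 * f (r • (w : E3)))
      ∂((volume : Measure E3).toSphere) := by
  have hdim : Module.finrank ℝ E3 - 1 = 2 := by simp
  have hmp := (volume : Measure E3).measurePreserving_homeomorphUnitSphereProd
  rw [hdim] at hmp
  let g : sphere (0 : E3) 1 × Ioi (0:ℝ) → ℝ := fun p => f ((p.2 : ℝ) • (p.1 : E3))
  have hg : ∀ x : ({0}ᶜ : Set E3), g (homeomorphUnitSphereProd E3 x) = f x := by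
    intro x
    have hx : (x : E3) ≠ 0 := x.2
    simp only [g, homeomorphUnitSphereProd_apply_snd_coe, homeomorphUnitSphereProd_apply_fst_coe]
    rw [smul_smul, mul_inv_cancel₀ (norm_ne_zero_iff.2 hx), one_smul]
  have hgi : Integrable g ((volume : Measure E3).toSphere.prod (.volumeIoiPow 2)) := by
    rw [← hmp.integrable_comp_emb (Homeomorph.measurableEmbedding _)]
    have : g ∘ (homeomorphUnitSphereProd E3) = f ∘ Subtype.val := by
      funext x; exact hg x
    rw [this, ← integrableOn_iff_comap_subtypeVal (measurableSet_singleton _).compl]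
    exact hf.integrableOn
  calc ∫ k, f k = ∫ x : ({0}ᶜ : Set E3), f x ∂((volume : Measure E3).comap (↑)) := by
        rw [integral_subtype_comap (measurableSet_singleton _).compl f,
          restrict_compl_singleton]
    _ = ∫ x : ({0}ᶜ : Set E3), g (homeomorphUnitSphereProd E3 x)
          ∂((volume : Measure E3).comap (↑)) := by simp only [hg]
    _ = ∫ p, g p ∂((volume : Measure E3).toSphere.prod (.volumeIoiPow 2)) :=
        hmp.integral_comp (Homeomorph.measurableEmbedding _) g
    _ = _ := by
      rw [integral_prod _ hgi]
      congr 1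
      funext w
      simp only [Measure.volumeIoiPow, ENNReal.ofReal]
      rw [integral_withDensity_eq_integral_smul]
      · simp only [g]
        rw [integral_subtype_comap measurableSet_Ioi
          fun a : ℝ ↦ Real.toNNReal (a ^ 2) • f (a • (w : E3))]
        refine setIntegral_congr_fun measurableSet_Ioi fun x hx ↦ ?_
        simp only [NNReal.smul_def, Real.coe_toNNReal _ (pow_nonneg (le_of_lt hx) 2), smul_eq_mul]
      · exact (measurable_subtype_coe.pow_const _).real_toNNReal

lemma Sig_smul_aux (v w : E3) (r : ℝ) (hr : 0 < r) (hw : ‖w‖ = 1) :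
    Sig v (r • w) = (r ^ 2)⁻¹ • Sig v w := by
  unfold Sig
  have h1 : ‖r • w‖ = r := by rw [norm_smul, hw, Real.norm_of_nonneg hr.le, mul_one]
  rw [h1, hw, real_inner_smul_left, smul_smul, smul_smul]
  have e1 : r * ⟪w, v⟫ / r = ⟪w, v⟫ := by field_simp
  have e2 : r * ⟪w, v⟫ / r ^ 2 * r = ⟪w, v⟫ := by field_simp
  rw [e1, e2]
  congr 1
  · simp only [one_pow, one_mul, div_one]
    rw [div_mul_eq_div_div, div_eq_mul_inv 2 (r ^ 2)]
    ring
  · simp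

lemma Sig_bound_aux (ν : ℝ) (hν1 : ν < 1) (v w : E3) (hv : ‖v‖ ≤ ν) (hw : ‖w‖ = 1) :
    ‖Sig v w‖ ≤ 4 / (1 - ν) := by
  unfold Sig
  have h0 : |⟪w, v⟫| ≤ ν := by
    have := abs_real_inner_le_norm w v
    rw [hw, one_mul] at this; linarith
  have h1 := (abs_le.1 h0).2
  have hp : 0 < 1 - ν := by linarith
  rw [hw, norm_smul]
  simp only [one_pow, one_mul, div_one]
  rw [Real.norm_of_nonneg (by apply div_nonneg <;> linarith)]
  have h2 : ‖v - ⟪w, v⟫ • w‖ ≤ 2 := by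
    refine (norm_sub_le _ _).trans ?_
    rw [norm_smul, hw, Real.norm_eq_abs]; linarith
  have h3 : 2 / (1 - ⟪w, v⟫) ≤ 2 / (1 - ν) := by
    apply div_le_div_of_nonneg_left <;> linarith
  calc _ ≤ 2 / (1 - ν) * 2 := by
        apply mul_le_mul h3 h2 (norm_nonneg _); positivity
    _ = _ := by ring

/-- the radial primitive -/
def Grad (σ b d : ℝ) : ℝ := (Real.sin (b * d) - Real.sin (σ * d)) / d

lemma radial_aux (σ b d : ℝ) (hd : d ≠ 0) :
    ∫ r in σ..b, Real.cos (r * d) = Grad σ b d := by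
  rw [intervalIntegral.integral_comp_mul_right _ hd, integral_cos, Grad, smul_eq_mul]
  field_simp

lemma Grad_bound (σ b d : ℝ) (hd : d ≠ 0) (hσ : 0 ≤ σ) (hb : σ ≤ b) : |Grad σ b d| ≤ b := by
  rw [Grad, abs_div, div_le_iff₀ (abs_pos.2 hd)]
  refine (Real.abs_sin_sub_sin_le _ _).trans ?_
  rw [← sub_mul, abs_mul, abs_of_nonneg (by linarith)]
  gcongr
  linarith

lemma sinc_lip (τ m b c c' : ℝ) (hτ : 0 < τ) (hm : 0 < m) (hb : 0 ≤ b) (hc : m ≤ |c|)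
    (hc' : m ≤ |c'|) :
    |Real.sin (b * (τ * c)) / (τ * c) - Real.sin (b * (τ * c')) / (τ * c')|
      ≤ 2 / m * b * |c - c'| := by
  have hc0 : c ≠ 0 := abs_pos.1 (by linarith)
  have hc0' : c' ≠ 0 := abs_pos.1 (by linarith)
  have e : Real.sin (b * (τ * c)) / (τ * c) - Real.sin (b * (τ * c')) / (τ * c')
      = (Real.sin (b * (τ * c)) - Real.sin (b * (τ * c'))) / (τ * c)
        + Real.sin (b * (τ * c')) * (c' - c) / (τ * c * c') := by
    field_simp; ring
  rw [e]
  refine (abs_add_le _ _).trans ?_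
  have p1 : |(Real.sin (b * (τ * c)) - Real.sin (b * (τ * c'))) / (τ * c)|
      ≤ b * |c - c'| / |c| := by
    rw [abs_div, abs_mul, abs_of_pos hτ, div_le_div_iff₀ (by positivity) (by positivity)]
    have := Real.abs_sin_sub_sin_le (b * (τ * c)) (b * (τ * c'))
    rw [show b * (τ * c) - b * (τ * c') = b * τ * (c - c') by ring, abs_mul,
      abs_of_nonneg (by positivity : 0 ≤ b * τ)] at this
    calc _ ≤ b * τ * |c - c'| * |c| := by gcongr
      _ = _ := by ring
  have p2 : |Real.sin (b * (τ * c')) * (c' - c) / (τ * c * c')| ≤ b * |c - c'| / |c| := by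
    rw [abs_div, abs_mul, abs_mul, abs_mul, abs_of_pos hτ,
      div_le_div_iff₀ (by positivity) (by positivity)]
    have := Real.abs_sin_le_abs (x := b * (τ * c'))
    rw [abs_mul, abs_mul, abs_of_pos hτ, abs_of_nonneg hb] at this
    rw [abs_sub_comm c' c]
    calc _ ≤ b * (τ * |c'|) * |c - c'| * |c| := by gcongr
      _ = _ := by ring
  have p3 : b * |c - c'| / |c| ≤ b * |c - c'| / m := by gcongr
  calc _ ≤ b * |c - c'| / m + b * |c - c'| / m := by linarith
    _ = _ := by ring

lemma Grad_lip (σ τ m b c c' : ℝ) (hτ : 0 < τ) (hm : 0 < m) (hσ : 0 ≤ σ) (hb : σ ≤ b)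
    (hc : m ≤ |c|) (hc' : m ≤ |c'|) :
    |Grad σ b (τ * c) - Grad σ b (τ * c')| ≤ 4 / m * b * |c - c'| := by
  have h1 := sinc_lip τ m b c c' hτ hm (hσ.trans hb) hc hc'
  have h2 := sinc_lip τ m σ c c' hτ hm hσ hc hc'
  have h3 : 2 / m * σ * |c - c'| ≤ 2 / m * b * |c - c'| := by gcongr
  have e : Grad σ b (τ * c) - Grad σ b (τ * c') =
      (Real.sin (b * (τ * c)) / (τ * c) - Real.sin (b * (τ * c')) / (τ * c'))
      - (Real.sin (σ * (τ * c)) / (τ * c) - Real.sin (σ * (τ * c')) / (τ * c')) := by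
    unfold Grad; ring
  rw [e]
  refine (abs_sub _ _).trans ?_
  calc _ ≤ 2 / m * b * |c - c'| + 2 / m * b * |c - c'| := by linarith
    _ = _ := by ring

lemma measurable_Sig (v : E3) : Measurable (Sig v) := by
  unfold Sig
  fun_prop

lemma measurableSet_annulus (a b : ℝ) : MeasurableSet (annulus a b) := by
  unfold annulus
  measurability

lemma Sig_bound_ann (ν : ℝ) (hν1 : ν < 1) (v k : E3) (σ : ℝ) (hσ : 0 < σ) (hv : ‖v‖ ≤ ν)
    (hk : σ ≤ ‖k‖) : ‖Sig v k‖ ≤ (σ ^ 2)⁻¹ * (4 / (1 - ν)) := by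
  have hk0 : 0 < ‖k‖ := by linarith
  have h1 : ‖(‖k‖⁻¹ • k)‖ = 1 := by
    rw [norm_smul, norm_inv, norm_norm, inv_mul_cancel₀ hk0.ne']
  have h2 := Sig_smul_aux v (‖k‖⁻¹ • k) ‖k‖ hk0 h1
  rw [smul_smul, mul_inv_cancel₀ hk0.ne', one_smul] at h2
  rw [h2, norm_smul, Real.norm_of_nonneg (by positivity)]
  have := Sig_bound_aux ν hν1 v _ hv h1
  gcongr

lemma inner_formula (ν : ℝ) (hν1 : ν < 1) (v u : E3) (hv : ‖v‖ ≤ ν) (hu : ‖u‖ ≤ ν)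
    (σ b τ : ℝ) (hσ : 0 < σ) (hb : σ ≤ b) (hτ : 0 < τ) :
    ⟪u, ∫ k in annulus σ b, Real.cos (⟪k, u⟫ * τ - ‖k‖ * τ) • Sig v k⟫
      = ∫ w : Metric.sphere (0 : E3) 1, ⟪u, Sig v w⟫ * Grad σ b (τ * (⟪(w : E3), u⟫ - 1))
        ∂((volume : Measure E3).toSphere) := by
  have hm := measurableSet_annulus σ b
  have hS := measurable_Sig v
  have hfin : volume (annulus σ b) ≠ ⊤ := by
    refine ((measure_mono ?_).trans_lt (measure_closedBall_lt_top (x := (0:E3)) (r := b))).ne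
    intro k hk; simpa using hk.2
  have hint : IntegrableOn (fun k : E3 => Real.cos (⟪k, u⟫ * τ - ‖k‖ * τ) • Sig v k)
      (annulus σ b) := by
    refine Measure.integrableOn_of_bounded hfin (M := (σ ^ 2)⁻¹ * (4 / (1 - ν))) ?_ ?_
    · apply Measurable.aestronglyMeasurable
      fun_prop
    · filter_upwards [ae_restrict_mem hm] with k hk
      rw [norm_smul]
      have h1 := Sig_bound_ann ν hν1 v k σ hσ hv hk.1
      have h2 : ‖Real.cos (⟪k, u⟫ * τ - ‖k‖ * τ)‖ ≤ 1 := Real.abs_cos_le_one _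
      calc _ ≤ 1 * ‖Sig v k‖ := by gcongr
        _ ≤ _ := by linarith
  rw [← integral_inner hint u, ← integral_indicator hm, polar_aux]
  · congr 1
    funext w
    have hw : ‖(w : E3)‖ = 1 := by simpa using w.2
    have hwu : ⟪(w : E3), u⟫ < 1 := by
      have := real_inner_le_norm (w : E3) u
      rw [hw] at this; linarith
    have hd : τ * (⟪(w : E3), u⟫ - 1) ≠ 0 := mul_ne_zero hτ.ne' (by linarith)
    rw [← radial_aux σ b _ hd, intervalIntegral.integral_of_le hb,
      ← integral_Icc_eq_integral_Ioc, ← integral_const_mul]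
    have : Set.Icc σ b = Set.Ioi 0 ∩ Set.Icc σ b := by
      ext x; simp only [Set.mem_inter_iff, Set.mem_Ioi, Set.mem_Icc]
      exact ⟨fun h => ⟨by linarith [h.1], h⟩, fun h => h.2⟩
    rw [this, ← setIntegral_indicator measurableSet_Icc]
    refine setIntegral_congr_fun measurableSet_Ioi fun r hr ↦ ?_
    have hr : 0 < r := hr
    have hn : ‖r • (w : E3)‖ = r := by
      rw [norm_smul, hw, Real.norm_of_nonneg hr.le, mul_one]
    by_cases h : r ∈ Set.Icc σ b
    · have h' : r • (w : E3) ∈ annulus σ b := by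
        simpa [annulus, hn] using h
      simp only [Set.indicator_of_mem h, Set.indicator_of_mem h']
      rw [Sig_smul_aux v w r hr hw, hn, real_inner_smul_left, real_inner_smul_right,
        real_inner_smul_right]
      rw [show r * ⟪(w : E3), u⟫ * τ - r * τ = r * (τ * (⟪(w : E3), u⟫ - 1)) by ring]
      field_simp
    · have h' : r • (w : E3) ∉ annulus σ b := by
        simpa [annulus, hn] using h
      simp only [Set.indicator_of_notMem h, Set.indicator_of_notMem h', mul_zero]
  · rw [integrable_indicator_iff hm]
    exact hint.const_inner u

/-- sphere integrand -/
def Hs (θ σ : ℝ) (v u : E3) (τ : ℝ) (w : E3) : ℝ :=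
  ⟪u, Sig v w⟫ * Grad σ (τ ^ (-θ)) (τ * (⟪w, u⟫ - 1))

lemma Hs_meas (θ σ : ℝ) (v u : E3) :
    Measurable (fun p : ℝ × Metric.sphere (0 : E3) 1 => Hs θ σ v u p.1 p.2) := by
  have hS := measurable_Sig v
  unfold Hs Grad
  fun_prop

lemma inner_sub_one_bound (ν : ℝ) (hν1 : ν < 1) (u w : E3) (hu : ‖u‖ ≤ ν) (hw : ‖w‖ = 1) :
    1 - ν ≤ |⟪w, u⟫ - 1| := by
  have := real_inner_le_norm w u
  rw [hw] at this
  rw [abs_sub_comm]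
  exact le_trans (by linarith) (le_abs_self _)

lemma Hs_bound (θ ν : ℝ) (hν1 : ν < 1) (σ : ℝ) (hσ : 0 < σ) (v u : E3)
    (hv : ‖v‖ ≤ ν) (hu : ‖u‖ ≤ ν) (τ : ℝ) (hτ : 0 < τ) (hb : σ ≤ τ ^ (-θ)) (w : E3)
    (hw : ‖w‖ = 1) : |Hs θ σ v u τ w| ≤ 4 / (1 - ν) * τ ^ (-θ) := by
  have hp : 0 < 1 - ν := by linarith
  have h1 := Sig_bound_aux ν hν1 v w hv hw
  have h2 := inner_sub_one_bound ν hν1 u w hu hw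
  have hc : ⟪w, u⟫ - 1 ≠ 0 := abs_pos.1 (by linarith)
  have h3 := Grad_bound σ (τ ^ (-θ)) (τ * (⟪w, u⟫ - 1)) (mul_ne_zero hτ.ne' hc) hσ.le hb
  rw [Hs, abs_mul]
  have h4 : |⟪u, Sig v w⟫| ≤ 4 / (1 - ν) := by
    refine (abs_real_inner_le_norm _ _).trans ?_
    calc _ ≤ 1 * ‖Sig v w‖ := by gcongr; linarith
      _ ≤ _ := by linarith
  gcongr

lemma Hs_lip (θ ν : ℝ) (hν1 : ν < 1) (σ : ℝ) (hσ : 0 < σ) (v u u' : E3)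
    (hv : ‖v‖ ≤ ν) (hu : ‖u‖ ≤ ν) (hu' : ‖u'‖ ≤ ν) (τ : ℝ) (hτ : 0 < τ) (hb : σ ≤ τ ^ (-θ))
    (w : E3) (hw : ‖w‖ = 1) :
    |Hs θ σ v u τ w - Hs θ σ v u' τ w|
      ≤ 4 / (1 - ν) * (1 + 4 / (1 - ν)) * ‖u - u'‖ * τ ^ (-θ) := by
  have hp : 0 < 1 - ν := by linarith
  have h1 := Sig_bound_aux ν hν1 v w hv hw
  have h2 := inner_sub_one_bound ν hν1 u w hu hw
  have h2' := inner_sub_one_bound ν hν1 u' w hu' hw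
  have hc : ⟪w, u⟫ - 1 ≠ 0 := abs_pos.1 (by linarith)
  have h3 := Grad_bound σ (τ ^ (-θ)) (τ * (⟪w, u⟫ - 1)) (mul_ne_zero hτ.ne' hc) hσ.le hb
  have h5 := Grad_lip σ τ (1 - ν) (τ ^ (-θ)) (⟪w, u⟫ - 1) (⟪w, u'⟫ - 1) hτ hp hσ.le hb h2 h2'
  have h4 : |⟪u', Sig v w⟫| ≤ 4 / (1 - ν) := by
    refine (abs_real_inner_le_norm _ _).trans ?_
    calc _ ≤ 1 * ‖Sig v w‖ := by gcongr; linarith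
      _ ≤ _ := by linarith
  have h6 : |⟪u - u', Sig v w⟫| ≤ ‖u - u'‖ * (4 / (1 - ν)) := by
    refine (abs_real_inner_le_norm _ _).trans ?_
    gcongr
  have h7 : |⟪w, u⟫ - 1 - (⟪w, u'⟫ - 1)| ≤ ‖u - u'‖ := by
    rw [sub_sub_sub_cancel_right, ← inner_sub_right]
    refine (abs_real_inner_le_norm _ _).trans ?_
    rw [hw, one_mul]
  have hb0 : 0 ≤ τ ^ (-θ) := by linarith
  have e : Hs θ σ v u τ w - Hs θ σ v u' τ w =
      ⟪u - u', Sig v w⟫ * Grad σ (τ ^ (-θ)) (τ * (⟪w, u⟫ - 1)) +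
      ⟪u', Sig v w⟫ * (Grad σ (τ ^ (-θ)) (τ * (⟪w, u⟫ - 1)) -
        Grad σ (τ ^ (-θ)) (τ * (⟪w, u'⟫ - 1))) := by
    rw [inner_sub_left]; unfold Hs; ring
  rw [e]
  refine (abs_add_le _ _).trans ?_
  rw [abs_mul, abs_mul]
  calc _ ≤ ‖u - u'‖ * (4 / (1 - ν)) * τ ^ (-θ) +
        4 / (1 - ν) * (4 / (1 - ν) * τ ^ (-θ) * ‖u - u'‖) := by
        gcongr
        exact h5.trans (by gcongr)
    _ = _ := by ring

theorem statement7 (θ α ν : ℝ) (hθ0 : 0 < θ) (hθ1 : θ < 1) (hα : 0 < α)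
    (hν0 : 0 < ν) (hν1 : ν < 1) :
    ∃ C : ℝ, ∀ σ : ℝ, 0 < σ → σ < 1 → ∀ s : ℝ, 1 ≤ s → s ≤ σ ^ (-(1/θ)) →
      ∀ v u u' : E3, ‖v‖ ≤ ν → ‖u‖ ≤ ν → ‖u'‖ ≤ ν →
      |gammaIR α θ v u σ s - gammaIR α θ v u' σ s| ≤ C * ‖u - u'‖ * s ^ (1 - θ) := by
  set μ : Measure (Metric.sphere (0 : E3) 1) := (volume : Measure E3).toSphere with hμ
  have hp : 0 < 1 - ν := by linarith
  set K : ℝ := 4 / (1 - ν) * (1 + 4 / (1 - ν)) with hK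
  have hK0 : 0 < K := by positivity
  refine ⟨α * (K * μ.real Set.univ / (1 - θ)), ?_⟩
  intro σ hσ0 hσ1 s hs1 hs v u u' hv hu hu'
  have hbτ : ∀ τ ∈ Set.Ioc 1 s, σ ≤ τ ^ (-θ) := by
    intro τ hτ
    have hτ0 : 0 < τ := by linarith [hτ.1]
    have h1 : τ ≤ σ ^ (-(1/θ)) := hτ.2.trans hs
    have h2 := Real.rpow_le_rpow_of_nonpos hτ0 h1 (by linarith : -θ ≤ 0)
    rw [← Real.rpow_mul hσ0.le, show -(1/θ) * -θ = 1 by field_simp, Real.rpow_one] at h2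
    exact h2
  have key : ∀ z : E3, ‖z‖ ≤ ν → gammaIR α θ v z σ s
      = -α * ∫ τ in (1:ℝ)..s, ∫ w : Metric.sphere (0 : E3) 1, Hs θ σ v z τ w ∂μ := by
    intro z hz
    unfold gammaIR
    rw [min_eq_left hs]
    congr 1
    refine intervalIntegral.integral_congr_ae (Filter.Eventually.of_forall fun τ hτ => ?_)
    rw [Set.uIoc_of_le hs1] at hτ
    exact inner_formula ν hν1 v z hv hz σ _ τ hσ0 (hbτ τ hτ) (by linarith [hτ.1])
  have hwn : ∀ w : Metric.sphere (0 : E3) 1, ‖(w : E3)‖ = 1 := fun w => by simpa using w.2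
  have hHi : ∀ z : E3, ‖z‖ ≤ ν → ∀ τ ∈ Set.Ioc 1 s,
      Integrable (fun w : Metric.sphere (0 : E3) 1 => Hs θ σ v z τ w) μ := by
    intro z hz τ hτ
    refine Integrable.of_bound (C := 4 / (1 - ν) * τ ^ (-θ)) ?_ ?_
    · exact ((Hs_meas θ σ v z).comp measurable_prodMk_left).aestronglyMeasurable
    · exact Filter.Eventually.of_forall fun w => Hs_bound θ ν hν1 σ hσ0 v z hv hz τ
        (by linarith [hτ.1]) (hbτ τ hτ) w (hwn w)
  have hrp : IntervalIntegrable (fun τ : ℝ => τ ^ (-θ)) volume 1 s :=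
    intervalIntegral.intervalIntegrable_rpow' (by linarith)
  have hFi : ∀ z : E3, ‖z‖ ≤ ν → IntervalIntegrable
      (fun τ => ∫ w : Metric.sphere (0 : E3) 1, Hs θ σ v z τ w ∂μ) volume 1 s := by
    intro z hz
    refine (hrp.const_mul (4 / (1 - ν) * μ.real Set.univ)).mono_fun ?_ ?_
    · exact (Hs_meas θ σ v z).stronglyMeasurable.integral_prod_right'.aestronglyMeasurable
    · rw [Set.uIoc_of_le hs1]
      filter_upwards [ae_restrict_mem measurableSet_Ioc] with τ hτ
      have hτ0 : 0 < τ := by linarith [hτ.1]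
      refine (norm_integral_le_of_norm_le_const (C := 4 / (1 - ν) * τ ^ (-θ)) ?_).trans ?_
      · exact Filter.Eventually.of_forall fun w => Hs_bound θ ν hν1 σ hσ0 v z hv hz τ
          hτ0 (hbτ τ hτ) w (hwn w)
      · refine le_trans (le_of_eq ?_) (le_abs_self _)
        ring
  rw [key u hu, key u' hu', ← mul_sub, ← intervalIntegral.integral_sub (hFi u hu) (hFi u' hu'),
    abs_mul, abs_neg, abs_of_pos hα, mul_assoc, mul_assoc]
  refine mul_le_mul_of_nonneg_left ?_ hα.le
  have hmain := intervalIntegral.norm_integral_le_of_norm_le (μ := volume) hs1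
    (f := fun τ => (∫ w : Metric.sphere (0 : E3) 1, Hs θ σ v u τ w ∂μ)
      - ∫ w : Metric.sphere (0 : E3) 1, Hs θ σ v u' τ w ∂μ)
    (g := fun τ => K * ‖u - u'‖ * μ.real Set.univ * τ ^ (-θ)) ?_ (hrp.const_mul _)
  · refine hmain.trans ?_
    rw [intervalIntegral.integral_const_mul, integral_rpow (Or.inl (by linarith))]
    rw [show -θ + 1 = 1 - θ by ring, Real.one_rpow]
    have hq : 0 < 1 - θ := by linarith
    calc _ ≤ K * ‖u - u'‖ * μ.real Set.univ * (s ^ (1 - θ) / (1 - θ)) := by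
          gcongr; linarith
      _ = _ := by ring
  · refine Filter.Eventually.of_forall fun τ hτ => ?_
    have hτ0 : 0 < τ := by linarith [hτ.1]
    rw [← integral_sub (hHi u hu τ hτ) (hHi u' hu' τ hτ)]
    refine (norm_integral_le_of_norm_le_const (C := K * ‖u - u'‖ * τ ^ (-θ)) ?_).trans ?_
    · exact Filter.Eventually.of_forall fun w => Hs_lip θ ν hν1 σ hσ0 v u u' hv hu hu' τ
          hτ0 (hbτ τ hτ) w (hwn w)
    · exact le_of_eq (by ring)
end
end
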